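/- arXiv:2003.05816 — 3 statements merged into one kernel-verified Lean document; each statement's English description precedes it below -/
import Mathlib

section
/- Let T>0 and let L:[0,T]→C_c^∞(ℝ^d) be supported in one fixed compact set K with, for every γ∈(0,1) and multi-index α, a bound ‖∂^α(L_t−L_s)‖_∞ ≤ C_{α,γ}|t−s|^γ. Let (b_n) be a sequence of tempered distributions converging to a tempered distribution b in S'(ℝ^d) (i.e. ⟨b_n,φ⟩→⟨b,φ⟩ for every Schwartz φ). Then there exists λ≥0 such that for every γ∈(0,1) and every multi-index β: sup_{0≤s<t≤T} sup_{x∈ℝ^d} (1+|x|²)^{−λ/2} |t−s|^{−γ} |∂^β(T_{s,t}b_n − T_{s,t}b)(x)| → 0 as n→∞, where T_{s,t}b(x)=⟨b,(L_t−L_s)(·−x)⟩. -/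
noncomputable section
open MeasureTheory Set Filter
open scoped ENNReal NNReal

abbrev Euc (d : ℕ) : Type := EuclideanSpace ℝ (Fin d)

open scoped Topology SchwartzMap LineDeriv ContDiff

namespace SchwartzMap

section Complete

variable {E F : Type*} [NormedAddCommGroup E] [NormedSpace ℝ E]
  [NormedAddCommGroup F] [NormedSpace ℝ F]

theorem eventually_seminorm_sub_lt_of_cauchySeq {u : ℕ → 𝓢(E, F)} (hu : CauchySeq u)
    (k n : ℕ) {ε : ℝ} (hε : 0 < ε) :
    ∃ N, ∀ i ≥ N, ∀ j ≥ N, SchwartzMap.seminorm ℝ k n (u i - u j) < ε := by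
  have h : Tendsto (fun q : ℕ × ℕ => u q.2 - u q.1) atTop (𝓝 0) := by
    have := hu.tendsto_uniformity
    rw [uniformity_eq_comap_nhds_zero, tendsto_comap_iff] at this
    exact this
  have h' := ((schwartz_withSeminorms ℝ E F).tendsto_nhds _ _).1 h (k, n) ε hε
  obtain ⟨⟨a, b⟩, hab⟩ := eventually_atTop.1 h'
  refine ⟨max a b, fun i hi j hj => ?_⟩
  have := hab (j, i) ⟨(le_max_left a b).trans hj, (le_max_right a b).trans hi⟩
  simpa using this

theorem iteratedFDeriv_coe_sub (f g : 𝓢(E, F)) (n : ℕ) (x : E) :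
    iteratedFDeriv ℝ n (⇑(f - g)) x = iteratedFDeriv ℝ n f x - iteratedFDeriv ℝ n g x := by
  have : (⇑(f - g)) = (f : E → F) - g := by ext; simp
  rw [this, iteratedFDeriv_sub_apply (f.smooth n).contDiffAt (g.smooth n).contDiffAt]

instance instCompleteSpace [CompleteSpace F] : CompleteSpace 𝓢(E, F) := by
  have : (uniformity 𝓢(E, F)).IsCountablyGenerated :=
    IsUniformAddGroup.uniformity_countably_generated
  refine UniformSpace.complete_of_cauchySeq_tendsto fun u hu => ?_
  have key : ∀ (k n : ℕ) (ε : ℝ), 0 < ε → ∃ N, ∀ i ≥ N, ∀ j ≥ N, ∀ x,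
      ‖x‖ ^ k * ‖iteratedFDeriv ℝ n (u i) x - iteratedFDeriv ℝ n (u j) x‖ < ε := by
    intro k n ε hε
    obtain ⟨N, hN⟩ := eventually_seminorm_sub_lt_of_cauchySeq hu k n hε
    refine ⟨N, fun i hi j hj x => lt_of_le_of_lt ?_ (hN i hi j hj)⟩
    rw [← iteratedFDeriv_coe_sub]
    exact le_seminorm ℝ k n _ x
  have hlim : ∀ n x, ∃ a, Tendsto (fun i => iteratedFDeriv ℝ n (u i) x) atTop (𝓝 a) := by
    intro n x
    refine cauchySeq_tendsto_of_complete (Metric.cauchySeq_iff.2 fun ε hε => ?_)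
    obtain ⟨N, hN⟩ := key 0 n ε hε
    exact ⟨N, fun i hi j hj => by simpa [dist_eq_norm] using hN i hi j hj x⟩
  choose G hG using hlim
  have hdist : ∀ (k n : ℕ) (ε : ℝ), 0 < ε → ∃ N, ∀ i ≥ N, ∀ x,
      ‖x‖ ^ k * ‖iteratedFDeriv ℝ n (u i) x - G n x‖ ≤ ε := by
    intro k n ε hε
    obtain ⟨N, hN⟩ := key k n ε hε
    refine ⟨N, fun i hi x => ?_⟩
    have ht : Tendsto (fun j => ‖x‖ ^ k *
        ‖iteratedFDeriv ℝ n (u i) x - iteratedFDeriv ℝ n (u j) x‖) atTop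
        (𝓝 (‖x‖ ^ k * ‖iteratedFDeriv ℝ n (u i) x - G n x‖)) :=
      ((hG n x).const_sub _).norm.const_mul _
    exact le_of_tendsto ht (eventually_atTop.2 ⟨N, fun j hj => (hN i hi j hj x).le⟩)
  have hunif : ∀ n, TendstoUniformly (fun i x => iteratedFDeriv ℝ n (u i) x) (G n) atTop := by
    intro n
    refine Metric.tendstoUniformly_iff.2 fun ε hε => ?_
    obtain ⟨N, hN⟩ := hdist 0 n (ε / 2) (half_pos hε)
    refine eventually_atTop.2 ⟨N, fun i hi x => ?_⟩
    have := hN i hi x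
    rw [dist_comm, dist_eq_norm]
    simp only [pow_zero, one_mul] at this
    linarith
  have hderiv : ∀ n x, HasFDerivAt (G n) (G (n + 1) x).curryLeft x := by
    intro n x
    refine hasFDerivAt_of_tendstoUniformly (l := atTop)
      (f := fun i x => iteratedFDeriv ℝ n (u i) x)
      (f' := fun i x => (iteratedFDeriv ℝ (n + 1) (u i) x).curryLeft)
      (g' := fun x => (G (n + 1) x).curryLeft) ?_ ?_ (hG n) x
    · exact ((continuousMultilinearCurryLeftEquiv ℝ (fun _ : Fin (n + 1) => E)
        F).isometry.uniformContinuous).comp_tendstoUniformly (hunif (n + 1))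
    · intro i y
      have h1 : Differentiable ℝ (iteratedFDeriv ℝ n (u i)) :=
        ((u i).smooth (n + 1 : ℕ)).differentiable_iteratedFDeriv (by exact_mod_cast n.lt_succ_self)
      exact (h1 y).hasFDerivAt
  have hT : HasFTaylorSeriesUpTo ((⊤ : ℕ∞) : WithTop ℕ∞) (fun x => (G 0 x).curry0)
      (fun x n => G n x) :=
    { zero_eq := fun x => rfl
      fderiv := fun m _ x => hderiv m x
      cont := fun m _ => continuous_iff_continuousAt.2 fun x => (hderiv m x).continuousAt }
  have hGd : ∀ n x, iteratedFDeriv ℝ n (fun x => (G 0 x).curry0) x = G n x := fun n x =>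
    (hT.eq_iteratedFDeriv (by exact_mod_cast le_top) x).symm
  let g : 𝓢(E, F) :=
    { toFun := fun x => (G 0 x).curry0
      smooth' := hT.contDiff
      decay' := fun k n => by
        obtain ⟨N, hN⟩ := hdist k n 1 one_pos
        refine ⟨1 + SchwartzMap.seminorm ℝ k n (u N), fun x => ?_⟩
        rw [hGd]
        have h1 := hN N le_rfl x
        have h2 := le_seminorm ℝ k n (u N) x
        have h3 : ‖G n x‖ ≤
            ‖iteratedFDeriv ℝ n (u N) x - G n x‖ + ‖iteratedFDeriv ℝ n (u N) x‖ := by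
          have := norm_sub_le (iteratedFDeriv ℝ n (u N) x) (iteratedFDeriv ℝ n (u N) x - G n x)
          rw [sub_sub_cancel] at this
          linarith
        calc ‖x‖ ^ k * ‖G n x‖ ≤ ‖x‖ ^ k * (‖iteratedFDeriv ℝ n (u N) x - G n x‖
              + ‖iteratedFDeriv ℝ n (u N) x‖) := by gcongr
          _ ≤ _ := by rw [mul_add]; linarith }
  refine ⟨g, ((schwartz_withSeminorms ℝ E F).tendsto_nhds_atTop _ _).2 fun ⟨k, n⟩ ε hε => ?_⟩
  obtain ⟨N, hN⟩ := hdist k n (ε / 2) (half_pos hε)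
  refine ⟨N, fun i hi => lt_of_le_of_lt ?_ (half_lt_self hε)⟩
  refine seminorm_le_bound ℝ k n _ (half_pos hε).le fun x => ?_
  rw [iteratedFDeriv_coe_sub]
  have : iteratedFDeriv ℝ n g x = G n x := hGd n x
  rw [this]
  exact hN i hi x

/-- A pointwise convergent sequence of continuous linear maps on Schwartz space is
equicontinuous. -/
theorem uniformEquicontinuous_of_tendsto [CompleteSpace F] {G : Type*} [NormedAddCommGroup G]
    [NormedSpace ℝ G] {u : ℕ → 𝓢(E, F) →L[ℝ] G}
    (hu : ∀ φ, ∃ a, Tendsto (fun n => u n φ) atTop (𝓝 a)) :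
    UniformEquicontinuous fun n => (u n : 𝓢(E, F) → G) := by
  have : (uniformity 𝓢(E, F)).IsCountablyGenerated :=
    IsUniformAddGroup.uniformity_countably_generated
  refine (norm_withSeminorms ℝ G).banach_steinhaus (𝓕 := u) fun _ φ => ?_
  obtain ⟨a, ha⟩ := hu φ
  exact ha.norm.bddAbove_range

/-- An equicontinuous sequence of linear maps on Schwartz space is bounded by a single finite
combination of Schwartz seminorms. -/
theorem exists_forall_norm_le_sup_seminorm {G : Type*} [NormedAddCommGroup G]
    [NormedSpace ℝ G] {u : ℕ → 𝓢(E, F) →L[ℝ] G}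
    (hu : UniformEquicontinuous fun n => (u n : 𝓢(E, F) → G)) :
    ∃ (s : Finset (ℕ × ℕ)) (C : ℝ), 0 ≤ C ∧
      ∀ n φ, ‖u n φ‖ ≤ C * s.sup (schwartzSeminormFamily ℝ E F) φ := by
  obtain ⟨p, hp, hpu⟩ :=
    ((norm_withSeminorms ℝ G).uniformEquicontinuous_iff_exists_continuous_seminorm
      (fun n => (u n : 𝓢(E, F) →ₗ[ℝ] G))).1 hu 0
  obtain ⟨s, C, -, hC⟩ := Seminorm.bound_of_continuous (schwartz_withSeminorms ℝ E F) p hp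
  exact ⟨s, C, C.2, fun n φ => (hpu n φ).trans (hC φ)⟩

end Complete

section Translation

variable {E F : Type*} [NormedAddCommGroup E] [NormedSpace ℝ E]
  [NormedAddCommGroup F] [NormedSpace ℝ F]

theorem pow_norm_mul_norm_iteratedFDeriv_le (φ : 𝓢(E, F)) (k n : ℕ) {z w : E} {r : ℝ}
    (hr : ‖w - z‖ ≤ r) :
    ‖z‖ ^ k * ‖iteratedFDeriv ℝ n φ w‖ ≤
      2 ^ k * (SchwartzMap.seminorm ℝ k n φ + r ^ k * SchwartzMap.seminorm ℝ 0 n φ) := by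
  have hr0 : 0 ≤ r := (norm_nonneg _).trans hr
  have hz : ‖z‖ ≤ ‖w‖ + r := by
    have := norm_sub_le w (w - z)
    rw [sub_sub_cancel] at this
    linarith
  have hpow : ‖z‖ ^ k ≤ 2 ^ k * (‖w‖ ^ k + r ^ k) :=
    calc ‖z‖ ^ k ≤ (‖w‖ + r) ^ k := by gcongr
      _ ≤ 2 ^ (k - 1) * (‖w‖ ^ k + r ^ k) := add_pow_le (norm_nonneg _) hr0 k
      _ ≤ 2 ^ k * (‖w‖ ^ k + r ^ k) := by
        gcongr
        · norm_num
        · omega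
  have h1 := le_seminorm ℝ k n φ w
  have h2 := norm_iteratedFDeriv_le_seminorm ℝ φ n w
  calc ‖z‖ ^ k * ‖iteratedFDeriv ℝ n φ w‖
      ≤ 2 ^ k * (‖w‖ ^ k + r ^ k) * ‖iteratedFDeriv ℝ n φ w‖ := by gcongr
    _ = 2 ^ k * (‖w‖ ^ k * ‖iteratedFDeriv ℝ n φ w‖ + r ^ k * ‖iteratedFDeriv ℝ n φ w‖) := by ring
    _ ≤ _ := by gcongr

theorem hasFDerivAt_iteratedFDeriv (φ : 𝓢(E, F)) (n : ℕ) (w : E) :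
    HasFDerivAt (iteratedFDeriv ℝ n φ) (fderiv ℝ (iteratedFDeriv ℝ n φ) w) w :=
  (((φ.smooth (n + 1 : ℕ)).differentiable_iteratedFDeriv
    (by exact_mod_cast n.lt_succ_self)) w).hasFDerivAt

theorem pow_norm_mul_norm_iteratedFDeriv_sub_le (φ : 𝓢(E, F)) (k n : ℕ) {z w : E} {r : ℝ}
    (hr : ‖w - z‖ ≤ r) :
    ‖z‖ ^ k * ‖iteratedFDeriv ℝ n φ w - iteratedFDeriv ℝ n φ z‖ ≤
      2 ^ k * (SchwartzMap.seminorm ℝ k (n + 1) φ + r ^ k * SchwartzMap.seminorm ℝ 0 (n + 1) φ)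
        * ‖w - z‖ := by
  have h := (convex_closedBall z r).norm_image_sub_le_of_norm_hasFDerivWithin_le
    (f := ‖z‖ ^ k • iteratedFDeriv ℝ n φ)
    (f' := fun y => ‖z‖ ^ k • fderiv ℝ (iteratedFDeriv ℝ n φ) y)
    (C := 2 ^ k * (SchwartzMap.seminorm ℝ k (n + 1) φ
      + r ^ k * SchwartzMap.seminorm ℝ 0 (n + 1) φ)) (x := z) (y := w)
    (fun y _ => ((hasFDerivAt_iteratedFDeriv φ n y).const_smul _).hasFDerivWithinAt)
    (fun y hy => by
      rw [norm_smul, norm_pow, norm_norm, norm_fderiv_iteratedFDeriv]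
      exact pow_norm_mul_norm_iteratedFDeriv_le φ k (n + 1) (mem_closedBall_iff_norm.1 hy))
    (Metric.mem_closedBall_self ((norm_nonneg _).trans hr)) (mem_closedBall_iff_norm.2 hr)
  rwa [Pi.smul_apply, Pi.smul_apply, ← smul_sub, norm_smul, norm_pow, norm_norm] at h

theorem pow_norm_mul_norm_iteratedFDeriv_taylor_le (φ : 𝓢(E, F)) (k n : ℕ) {z w : E} {r : ℝ}
    (hr : ‖w - z‖ ≤ r) :
    ‖z‖ ^ k * ‖iteratedFDeriv ℝ n φ w - iteratedFDeriv ℝ n φ z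
        - fderiv ℝ (iteratedFDeriv ℝ n φ) z (w - z)‖ ≤
      2 ^ k * (SchwartzMap.seminorm ℝ k (n + 2) φ + r ^ k * SchwartzMap.seminorm ℝ 0 (n + 2) φ)
        * r * ‖w - z‖ := by
  have hr0 : 0 ≤ r := (norm_nonneg _).trans hr
  have h := (convex_closedBall z r).norm_image_sub_le_of_norm_hasFDerivWithin_le'
    (f := ‖z‖ ^ k • iteratedFDeriv ℝ n φ)
    (f' := fun y => ‖z‖ ^ k • fderiv ℝ (iteratedFDeriv ℝ n φ) y)
    (φ := ‖z‖ ^ k • fderiv ℝ (iteratedFDeriv ℝ n φ) z)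
    (C := 2 ^ k * (SchwartzMap.seminorm ℝ k (n + 2) φ
      + r ^ k * SchwartzMap.seminorm ℝ 0 (n + 2) φ) * r) (x := z) (y := w)
    (fun y _ => ((hasFDerivAt_iteratedFDeriv φ n y).const_smul _).hasFDerivWithinAt)
    (fun y hy => by
      rw [← smul_sub, norm_smul, norm_pow, norm_norm, ← dist_eq_norm, fderiv_iteratedFDeriv,
        Function.comp_apply, Function.comp_apply, LinearIsometryEquiv.dist_map, dist_eq_norm]
      have hy' := mem_closedBall_iff_norm.1 hy
      refine (pow_norm_mul_norm_iteratedFDeriv_sub_le φ k (n + 1) hy').trans ?_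
      gcongr)
    (Metric.mem_closedBall_self hr0) (mem_closedBall_iff_norm.2 hr)
  rwa [Pi.smul_apply, Pi.smul_apply, ← smul_sub, _root_.smul_apply, ← smul_sub, norm_smul,
    norm_pow, norm_norm] at h

theorem iteratedFDeriv_compSubConstCLM (φ : 𝓢(E, F)) (n : ℕ) (a z : E) :
    iteratedFDeriv ℝ n (φ.compSubConstCLM ℝ a) z = iteratedFDeriv ℝ n φ (z - a) :=
  iteratedFDeriv_comp_sub n a z

theorem lineDerivOp_comm (v w : E) (φ : 𝓢(E, F)) :
    ∂_{v} (∂_{w} φ) = ∂_{w} (∂_{v} φ : 𝓢(E, F)) := by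
  have h (v w z : E) : (∂_{v} (∂_{w} φ : 𝓢(E, F)) : 𝓢(E, F)) z = fderiv ℝ (fderiv ℝ φ) z v w := by
    rw [lineDerivOp_apply_eq_fderiv]
    have h1 : ⇑(∂_{w} φ : 𝓢(E, F)) = fun y => fderiv ℝ φ y w := rfl
    have h2 : DifferentiableAt ℝ (fderiv ℝ φ) z := (fderivCLM ℝ E F φ).differentiableAt
    rw [h1, fderiv_clm_apply h2 (differentiableAt_const w)]
    simp
  ext z
  rw [h, h]
  exact ((φ.smooth 2).contDiffAt.isSymmSndFDerivAt (by simp)) v w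

theorem lineDerivOp_iteratedLineDerivOp_comm {n : ℕ} (h : E) (v : Fin n → E) (φ : 𝓢(E, F)) :
    ∂_{h} (∂^{v} φ) = ∂^{v} (∂_{h} φ : 𝓢(E, F)) := by
  induction n with
  | zero => simp
  | succ n ih =>
    rw [LineDeriv.iteratedLineDerivOp_succ_left, LineDeriv.iteratedLineDerivOp_succ_left,
      lineDerivOp_comm, ih]

theorem iteratedFDeriv_lineDerivOp (φ : 𝓢(E, F)) (n : ℕ) (h z : E) :
    iteratedFDeriv ℝ n (∂_{h} φ : 𝓢(E, F)) z = fderiv ℝ (iteratedFDeriv ℝ n φ) z h := by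
  ext v
  rw [← iteratedLineDerivOp_eq_iteratedFDeriv, ← lineDerivOp_iteratedLineDerivOp_comm,
    fderiv_iteratedFDeriv]
  have := iteratedLineDerivOp_eq_iteratedFDeriv (f := φ) (x := z)
    (m := (Fin.cons h v : Fin (n + 1) → E))
  rw [LineDeriv.iteratedLineDerivOp_succ_left] at this
  simpa using this

theorem seminorm_compSubConstCLM_le (φ : 𝓢(E, F)) (k n : ℕ) (a : E) :
    SchwartzMap.seminorm ℝ k n (φ.compSubConstCLM ℝ a) ≤
      2 ^ k * (SchwartzMap.seminorm ℝ k n φ + ‖a‖ ^ k * SchwartzMap.seminorm ℝ 0 n φ) := by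
  refine seminorm_le_bound ℝ k n _ (by positivity) fun z => ?_
  rw [iteratedFDeriv_compSubConstCLM]
  exact pow_norm_mul_norm_iteratedFDeriv_le φ k n (by simp)

theorem seminorm_compSubConstCLM_sub_le (φ : 𝓢(E, F)) (k n : ℕ) (a : E) :
    SchwartzMap.seminorm ℝ k n (φ.compSubConstCLM ℝ a - φ) ≤
      2 ^ k * (SchwartzMap.seminorm ℝ k (n + 1) φ
        + ‖a‖ ^ k * SchwartzMap.seminorm ℝ 0 (n + 1) φ) * ‖a‖ := by
  refine seminorm_le_bound ℝ k n _ (by positivity) fun z => ?_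
  rw [iteratedFDeriv_coe_sub, iteratedFDeriv_compSubConstCLM]
  have := pow_norm_mul_norm_iteratedFDeriv_sub_le φ k n (z := z) (w := z - a) (r := ‖a‖) (by simp)
  simpa using this

theorem seminorm_compSubConstCLM_taylor_le (φ : 𝓢(E, F)) (k n : ℕ) (a : E) :
    SchwartzMap.seminorm ℝ k n (φ.compSubConstCLM ℝ a - φ - ∂_{-a} φ) ≤
      2 ^ k * (SchwartzMap.seminorm ℝ k (n + 2) φ
        + ‖a‖ ^ k * SchwartzMap.seminorm ℝ 0 (n + 2) φ) * ‖a‖ * ‖a‖ := by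
  refine seminorm_le_bound ℝ k n _ (by positivity) fun z => ?_
  rw [iteratedFDeriv_coe_sub, iteratedFDeriv_coe_sub, iteratedFDeriv_compSubConstCLM,
    iteratedFDeriv_lineDerivOp]
  have := pow_norm_mul_norm_iteratedFDeriv_taylor_le φ k n (z := z) (w := z - a) (r := ‖a‖)
    (by simp)
  simpa only [sub_sub_cancel_left, norm_neg] using this

theorem tendsto_compSubConstCLM_nhds_zero (φ : 𝓢(E, F)) :
    Tendsto (fun a => φ.compSubConstCLM ℝ a) (𝓝 0) (𝓝 φ) := by
  refine ((schwartz_withSeminorms ℝ E F).tendsto_nhds _ _).2 fun ⟨k, n⟩ ε hε => ?_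
  have hc : Continuous fun a : E => 2 ^ k * (SchwartzMap.seminorm ℝ k (n + 1) φ
      + ‖a‖ ^ k * SchwartzMap.seminorm ℝ 0 (n + 1) φ) * ‖a‖ := by fun_prop
  have ht := hc.tendsto 0
  simp only [norm_zero, mul_zero] at ht
  filter_upwards [ht.eventually_lt_const hε] with a ha
  exact (seminorm_compSubConstCLM_sub_le φ k n a).trans_lt ha

theorem continuous_compSubConstCLM_uncurry :
    Continuous fun q : E × 𝓢(E, F) => q.2.compSubConstCLM ℝ q.1 := by
  refine continuous_iff_continuousAt.2 fun ⟨x₀, φ₀⟩ => ?_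
  have hsmall : Tendsto (fun q : E × 𝓢(E, F) => (q.2 - φ₀).compSubConstCLM ℝ q.1)
      (𝓝 (x₀, φ₀)) (𝓝 0) := by
    refine ((schwartz_withSeminorms ℝ E F).tendsto_nhds _ _).2 fun ⟨k, n⟩ ε hε => ?_
    have hp (k n : ℕ) : Continuous (SchwartzMap.seminorm ℝ k n : 𝓢(E, F) → ℝ) :=
      (schwartz_withSeminorms ℝ E F).continuous_seminorm (k, n)
    have hc : Continuous fun q : E × 𝓢(E, F) => 2 ^ k * (SchwartzMap.seminorm ℝ k n (q.2 - φ₀)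
        + ‖q.1‖ ^ k * SchwartzMap.seminorm ℝ 0 n (q.2 - φ₀)) := by
      have h1 := (hp k n).comp (continuous_snd.sub continuous_const :
        Continuous fun q : E × 𝓢(E, F) => q.2 - φ₀)
      have h2 := (hp 0 n).comp (continuous_snd.sub continuous_const :
        Continuous fun q : E × 𝓢(E, F) => q.2 - φ₀)
      exact continuous_const.mul (h1.add ((continuous_fst.norm.pow k).mul h2))
    have ht := hc.tendsto (x₀, φ₀)
    simp only [sub_self, map_zero, mul_zero, add_zero] at ht
    filter_upwards [ht.eventually_lt_const hε] with q hq
    rw [sub_zero]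
    exact (seminorm_compSubConstCLM_le (q.2 - φ₀) k n q.1).trans_lt hq
  have hmain : Tendsto (fun q : E × 𝓢(E, F) =>
      (φ₀.compSubConstCLM ℝ (q.1 - x₀)).compSubConstCLM ℝ x₀) (𝓝 (x₀, φ₀))
      (𝓝 (φ₀.compSubConstCLM ℝ x₀)) := by
    have h0 : Tendsto (fun q : E × 𝓢(E, F) => q.1 - x₀) (𝓝 (x₀, φ₀)) (𝓝 0) := by
      have : Continuous fun q : E × 𝓢(E, F) => q.1 - x₀ := by fun_prop
      simpa using this.tendsto (x₀, φ₀)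
    exact ((compSubConstCLM ℝ x₀).continuous.tendsto φ₀).comp
      ((tendsto_compSubConstCLM_nhds_zero φ₀).comp h0)
  have hsum := hsmall.add hmain
  rw [zero_add] at hsum
  refine hsum.congr fun q => ?_
  rw [compSubConstCLM_comp, sub_add_cancel, map_sub, sub_add_cancel]

end Translation

section Averaging

variable {E F G : Type*} [NormedAddCommGroup E] [NormedAddCommGroup F] [NormedSpace ℝ F]
  [NormedAddCommGroup G] [NormedSpace ℝ G]

theorem tendsto_inv_norm_smul_compSubConstCLM_taylor [NormedSpace ℝ E] (φ : 𝓢(E, F)) :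
    Tendsto (fun h : E => ‖h‖⁻¹ • (φ.compSubConstCLM ℝ h - φ - ∂_{-h} φ)) (𝓝 0) (𝓝 0) := by
  refine ((schwartz_withSeminorms ℝ E F).tendsto_nhds _ _).2 fun ⟨k, n⟩ ε hε => ?_
  have hc : Continuous fun a : E => 2 ^ k * (SchwartzMap.seminorm ℝ k (n + 2) φ
      + ‖a‖ ^ k * SchwartzMap.seminorm ℝ 0 (n + 2) φ) * ‖a‖ := by fun_prop
  have ht := hc.tendsto 0
  simp only [norm_zero, mul_zero] at ht
  filter_upwards [ht.eventually_lt_const hε] with a ha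
  rw [sub_zero, schwartzSeminormFamily_apply, map_smul_eq_mul, norm_inv, norm_norm]
  refine lt_of_le_of_lt ?_ ha
  rcases eq_or_ne a 0 with rfl | ha0
  · simp
  · have ha0' : 0 < ‖a‖ := norm_pos_iff.2 ha0
    rw [inv_mul_le_iff₀ ha0', mul_comm ‖a‖]
    exact seminorm_compSubConstCLM_taylor_le φ k n a

theorem hasFDerivAt_apply_compSubConstCLM [NormedSpace ℝ E] (u : 𝓢(E, F) →L[ℝ] G) (φ : 𝓢(E, F))
    (x : E) {L : E →L[ℝ] G} (hL : ∀ v, L v = -u ((∂_{v} φ).compSubConstCLM ℝ x)) :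
    HasFDerivAt (fun y => u (φ.compSubConstCLM ℝ y)) L x := by
  rw [hasFDerivAt_iff_tendsto]
  have h0 : Tendsto (fun y : E => y - x) (𝓝 x) (𝓝 0) := by
    have hc : Continuous fun y : E => y - x := by fun_prop
    simpa using hc.tendsto x
  have h := (((u.comp (compSubConstCLM ℝ x)).continuous.tendsto 0).comp
    ((tendsto_inv_norm_smul_compSubConstCLM_taylor φ).comp h0)).norm
  rw [map_zero, norm_zero] at h
  refine h.congr fun y => ?_
  have hneg : (∂_{-(y - x)} φ : 𝓢(E, F)) = -∂_{y - x} φ := by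
    ext z
    simp [lineDerivOp_apply_eq_fderiv]
  simp only [Function.comp_apply, map_smul, norm_smul, norm_inv, norm_norm]
  congr 2
  rw [hL, hneg, sub_neg_eq_add, sub_neg_eq_add]
  simp only [ContinuousLinearMap.comp_apply, map_add, map_sub, compSubConstCLM_comp,
    sub_add_cancel]

variable [InnerProductSpace ℝ E] {κ : Type*} [Fintype κ]

theorem hasFDerivAt_apply_compSubConstCLM_sum (b : OrthonormalBasis κ ℝ E)
    (u : 𝓢(E, F) →L[ℝ] G) (φ : 𝓢(E, F)) (x : E) :
    HasFDerivAt (fun y => u (φ.compSubConstCLM ℝ y))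
      (∑ i, (-(ContinuousLinearMap.smulRightL ℝ E G (innerSL ℝ (b i))))
        (u ((∂_{b i} φ).compSubConstCLM ℝ x))) x := by
  refine hasFDerivAt_apply_compSubConstCLM u φ x fun v => ?_
  have hv : (∂_{v} φ : 𝓢(E, F)) = ∑ i, inner ℝ (b i) v • (∂_{b i} φ : 𝓢(E, F)) := by
    ext z
    conv_lhs => rw [lineDerivOp_apply_eq_fderiv, ← b.sum_repr' v, map_sum]
    simp [lineDerivOp_apply_eq_fderiv]
  rw [hv]
  simp [map_sum]

theorem contDiff_apply_compSubConstCLM [FiniteDimensional ℝ E] (u : 𝓢(E, F) →L[ℝ] G)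
    (φ : 𝓢(E, F)) (k : ℕ) : ContDiff ℝ k fun y => u (φ.compSubConstCLM ℝ y) := by
  induction k generalizing φ with
  | zero =>
    exact contDiff_zero.2 (continuous_iff_continuousAt.2 fun x =>
      (hasFDerivAt_apply_compSubConstCLM_sum (stdOrthonormalBasis ℝ E) u φ x).continuousAt)
  | succ k ih =>
    refine contDiff_succ_iff_hasFDerivAt.2 ⟨_, ?_,
      hasFDerivAt_apply_compSubConstCLM_sum (stdOrthonormalBasis ℝ E) u φ⟩
    exact ContDiff.sum fun i _ => (ContinuousLinearMap.contDiff _).comp (ih _)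

theorem norm_iteratedFDeriv_succ_apply_compSubConstCLM_le [FiniteDimensional ℝ E]
    (b : OrthonormalBasis κ ℝ E) (u : 𝓢(E, F) →L[ℝ] G) (φ : 𝓢(E, F)) (k : ℕ) (x : E) :
    ‖iteratedFDeriv ℝ (k + 1) (fun y => u (φ.compSubConstCLM ℝ y)) x‖ ≤
      ∑ i, ‖iteratedFDeriv ℝ k (fun y => u ((∂_{b i} φ).compSubConstCLM ℝ y)) x‖ := by
  rw [← norm_iteratedFDeriv_fderiv]
  have h1 : fderiv ℝ (fun y => u (φ.compSubConstCLM ℝ y)) = fun y =>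
      ∑ i, ((-(ContinuousLinearMap.smulRightL ℝ E G (innerSL ℝ (b i)))) ∘
        fun y => u ((∂_{b i} φ).compSubConstCLM ℝ y)) y :=
    funext fun y => (hasFDerivAt_apply_compSubConstCLM_sum b u φ y).fderiv
  have hcd (i : κ) := contDiff_apply_compSubConstCLM u (∂_{b i} φ) k
  rw [h1, iteratedFDeriv_fun_sum_apply fun i _ =>
    ((ContinuousLinearMap.contDiff _).comp (hcd i)).contDiffAt]
  refine (norm_sum_le _ _).trans (Finset.sum_le_sum fun i _ => ?_)
  refine (ContinuousLinearMap.norm_iteratedFDeriv_comp_left _ (hcd i).contDiffAt le_rfl).trans ?_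
  refine mul_le_of_le_one_left (norm_nonneg _) ?_
  rw [norm_neg]
  refine ContinuousLinearMap.opNorm_le_bound _ zero_le_one fun c => ?_
  simp [ContinuousLinearMap.norm_smulRight_apply]

theorem sup_seminorm_compSubConstCLM_le {s : Finset (ℕ × ℕ)} {m : ℕ}
    (hm : ∀ q ∈ s, q.1 ≤ m) (φ : 𝓢(E, F)) (x : E) :
    s.sup (schwartzSeminormFamily ℝ E F) (φ.compSubConstCLM ℝ x) ≤
      2 ^ m * (1 + ‖x‖ ^ 2) ^ m *
        ∑ q ∈ s, (SchwartzMap.seminorm ℝ q.1 q.2 φ + SchwartzMap.seminorm ℝ 0 q.2 φ) := by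
  refine Seminorm.finset_sup_apply_le (by positivity) fun q hq => ?_
  have hy : 1 ≤ 1 + ‖x‖ ^ 2 := by nlinarith [sq_nonneg ‖x‖]
  have hxy : ‖x‖ ≤ 1 + ‖x‖ ^ 2 := by nlinarith [sq_nonneg (‖x‖ - 1)]
  have hx : ‖x‖ ^ q.1 ≤ (1 + ‖x‖ ^ 2) ^ m :=
    (pow_le_pow_left₀ (norm_nonneg x) hxy _).trans (pow_le_pow_right₀ hy (hm q hq))
  have h1 : 1 ≤ (1 + ‖x‖ ^ 2) ^ m := one_le_pow₀ hy
  have hp : 0 ≤ SchwartzMap.seminorm ℝ q.1 q.2 φ := apply_nonneg _ _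
  calc SchwartzMap.seminorm ℝ q.1 q.2 (φ.compSubConstCLM ℝ x)
      ≤ 2 ^ q.1 * (SchwartzMap.seminorm ℝ q.1 q.2 φ
          + ‖x‖ ^ q.1 * SchwartzMap.seminorm ℝ 0 q.2 φ) := seminorm_compSubConstCLM_le φ _ _ x
    _ ≤ 2 ^ m * ((1 + ‖x‖ ^ 2) ^ m * SchwartzMap.seminorm ℝ q.1 q.2 φ
          + (1 + ‖x‖ ^ 2) ^ m * SchwartzMap.seminorm ℝ 0 q.2 φ) := by
        gcongr
        · norm_num
        · exact hm q hq
        · exact le_mul_of_one_le_left hp h1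
    _ = 2 ^ m * (1 + ‖x‖ ^ 2) ^ m *
          (SchwartzMap.seminorm ℝ q.1 q.2 φ + SchwartzMap.seminorm ℝ 0 q.2 φ) := by ring
    _ ≤ _ := by
        gcongr
        exact Finset.single_le_sum
          (f := fun q : ℕ × ℕ => SchwartzMap.seminorm ℝ q.1 q.2 φ + SchwartzMap.seminorm ℝ 0 q.2 φ)
          (fun _ _ => by positivity) hq

variable [FiniteDimensional ℝ E] {X : Type*} [TopologicalSpace X] [CompactSpace X]

theorem exists_forall_norm_apply_compSubConstCLM_le {u : ℕ → 𝓢(E, F) →L[ℝ] G}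
    (hequi : UniformEquicontinuous fun n => (u n : 𝓢(E, F) → G))
    (hu : ∀ φ, Tendsto (fun n => u n φ) atTop (𝓝 0)) {s : Finset (ℕ × ℕ)} {C : ℝ} (hC : 0 ≤ C)
    (hbound : ∀ n φ, ‖u n φ‖ ≤ C * s.sup (schwartzSeminormFamily ℝ E F) φ)
    {m : ℕ} (hm : ∀ q ∈ s, q.1 ≤ m) {g : X → 𝓢(E, F)} (hg : Continuous g) {ε : ℝ} (hε : 0 < ε) :
    ∃ N, ∀ n ≥ N, ∀ i x, ‖u n ((g i).compSubConstCLM ℝ x)‖ ≤ ε * (1 + ‖x‖ ^ 2) ^ (m + 1) := by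
  have hp (k n : ℕ) : Continuous (SchwartzMap.seminorm ℝ k n : 𝓢(E, F) → ℝ) :=
    (schwartz_withSeminorms ℝ E F).continuous_seminorm (k, n)
  have hQ : Continuous fun i => ∑ q ∈ s,
      (SchwartzMap.seminorm ℝ q.1 q.2 (g i) + SchwartzMap.seminorm ℝ 0 q.2 (g i)) :=
    continuous_finsetSum _ fun q _ => ((hp _ _).comp hg).add ((hp _ _).comp hg)
  obtain ⟨B, hB⟩ := (isCompact_range hQ).bddAbove
  have hlarge (n : ℕ) (i : X) (x : E) :
      ‖u n ((g i).compSubConstCLM ℝ x)‖ ≤ C * 2 ^ m * B * (1 + ‖x‖ ^ 2) ^ m :=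
    calc ‖u n ((g i).compSubConstCLM ℝ x)‖
        ≤ C * (2 ^ m * (1 + ‖x‖ ^ 2) ^ m * B) := by
          refine (hbound n _).trans ?_
          gcongr
          refine (sup_seminorm_compSubConstCLM_le hm (g i) x).trans ?_
          gcongr
          exact hB ⟨i, rfl⟩
      _ = _ := by ring
  set R := C * 2 ^ m * B / ε with hR
  have : CompactSpace (Metric.closedBall (0 : E) R) :=
    isCompact_iff_compactSpace.1 (isCompact_closedBall 0 R)
  have hΦ : Continuous fun q : X × Metric.closedBall (0 : E) R =>
      (g q.1).compSubConstCLM ℝ (q.2 : E) :=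
    continuous_compSubConstCLM_uncurry.comp
      ((continuous_subtype_val.comp continuous_snd).prodMk (hg.comp continuous_fst))
  have hE : Equicontinuous fun n (q : X × Metric.closedBall (0 : E) R) =>
      u n ((g q.1).compSubConstCLM ℝ (q.2 : E)) := fun q U hU =>
    (hΦ.tendsto q).eventually (hequi.equicontinuous _ U hU)
  have hT := (hE.tendsto_uniformFun_iff_pi atTop fun _ => 0).2
    (tendsto_pi_nhds.2 fun q => hu _)
  rw [UniformFun.tendsto_iff_tendstoUniformly] at hT
  obtain ⟨N, hN⟩ := eventually_atTop.1 (Metric.tendstoUniformly_iff.1 hT ε hε)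
  refine ⟨N, fun n hn i x => ?_⟩
  have hy : 1 ≤ 1 + ‖x‖ ^ 2 := by nlinarith [sq_nonneg ‖x‖]
  have hxy : ‖x‖ ≤ 1 + ‖x‖ ^ 2 := by nlinarith [sq_nonneg (‖x‖ - 1)]
  rcases le_total R (1 + ‖x‖ ^ 2) with hx | hx
  · refine (hlarge n i x).trans ?_
    rw [hR, div_le_iff₀ hε] at hx
    calc C * 2 ^ m * B * (1 + ‖x‖ ^ 2) ^ m
        ≤ (1 + ‖x‖ ^ 2) * ε * (1 + ‖x‖ ^ 2) ^ m := by gcongr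
      _ = _ := by ring
  · have h := hN n hn (i, ⟨x, mem_closedBall_zero_iff.2 (hxy.trans hx)⟩)
    simp only [UniformFun.toFun_ofFun, Function.comp_apply, dist_zero_left] at h
    exact h.le.trans (le_mul_of_one_le_right hε.le (one_le_pow₀ hy))

theorem exists_forall_norm_iteratedFDeriv_apply_compSubConstCLM_le {u : ℕ → 𝓢(E, F) →L[ℝ] G}
    (hequi : UniformEquicontinuous fun n => (u n : 𝓢(E, F) → G))
    (hu : ∀ φ, Tendsto (fun n => u n φ) atTop (𝓝 0)) {s : Finset (ℕ × ℕ)} {C : ℝ} (hC : 0 ≤ C)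
    (hbound : ∀ n φ, ‖u n φ‖ ≤ C * s.sup (schwartzSeminormFamily ℝ E F) φ)
    {m : ℕ} (hm : ∀ q ∈ s, q.1 ≤ m) (k : ℕ) {g : X → 𝓢(E, F)} (hg : Continuous g)
    {ε : ℝ} (hε : 0 < ε) :
    ∃ N, ∀ n ≥ N, ∀ i x, ‖iteratedFDeriv ℝ k (fun y => u n ((g i).compSubConstCLM ℝ y)) x‖ ≤
      ε * (1 + ‖x‖ ^ 2) ^ (m + 1) := by
  induction k generalizing g ε with
  | zero =>
    simpa only [norm_iteratedFDeriv_zero] using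
      exists_forall_norm_apply_compSubConstCLM_le hequi hu hC hbound hm hg hε
  | succ k ih =>
    set b := stdOrthonormalBasis ℝ E
    have hD : 0 < ((Module.finrank ℝ E : ℕ) : ℝ) + 1 := by positivity
    have hstep (j : Fin (Module.finrank ℝ E)) :=
      ih (g := fun i => ∂_{b j} (g i))
        ((LineDeriv.lineDerivOpCLM ℝ 𝓢(E, F) (b j)).continuous.comp hg)
        (div_pos hε hD)
    choose N hN using hstep
    refine ⟨Finset.univ.sup N, fun n hn i x => ?_⟩
    refine (norm_iteratedFDeriv_succ_apply_compSubConstCLM_le b (u n) (g i) k x).trans ?_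
    refine (Finset.sum_le_sum fun j _ =>
      hN j n ((Finset.le_sup (Finset.mem_univ j)).trans hn) i x).trans ?_
    rw [Finset.sum_const, Finset.card_univ, Fintype.card_fin, nsmul_eq_mul, ← mul_assoc]
    gcongr
    rw [← mul_div_assoc, div_le_iff₀ hD]
    nlinarith

end Averaging

section Increments

variable {E F : Type*} [NormedAddCommGroup E] [NormedSpace ℝ E]
  [NormedAddCommGroup F] [NormedSpace ℝ F]

theorem seminorm_le_of_tsupport_subset {φ : 𝓢(E, F)} {R M : ℝ} {n : ℕ} (hR : 0 ≤ R)
    (hφ : tsupport φ ⊆ Metric.closedBall 0 R) (hM : ∀ x, ‖iteratedFDeriv ℝ n φ x‖ ≤ M) (k : ℕ) :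
    SchwartzMap.seminorm ℝ k n φ ≤ R ^ k * M := by
  have hM0 : 0 ≤ M := (norm_nonneg _).trans (hM 0)
  refine seminorm_le_bound ℝ k n _ (by positivity) fun x => ?_
  by_cases hx : x ∈ tsupport φ
  · have := mem_closedBall_zero_iff.1 (hφ hx)
    gcongr
    exact hM x
  · rw [Function.notMem_support.1 fun h => hx (support_iteratedFDeriv_subset n h), norm_zero,
      mul_zero]
    positivity

/-- If `A` is Hölder continuous of every exponent below one, its increments divided by
`(t - s) ^ γ` extend continuously by zero to the diagonal. -/
theorem continuousOn_rpow_smul_sub {A : ℝ → 𝓢(E, F)} {T : ℝ}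
    (hA : ∀ γ ∈ Ioo (0 : ℝ) 1, ∀ k n : ℕ, ∃ C : ℝ, ∀ s t : ℝ, 0 ≤ s → s ≤ t → t ≤ T →
      SchwartzMap.seminorm ℝ k n (A t - A s) ≤ C * (t - s) ^ γ)
    {γ : ℝ} (hγ : γ ∈ Ioo (0 : ℝ) 1) :
    ContinuousOn (fun q : ℝ × ℝ => (q.2 - q.1) ^ (-γ) • (A q.2 - A q.1))
      {q | 0 ≤ q.1 ∧ q.1 ≤ q.2 ∧ q.2 ≤ T} := by
  have hAcont : ContinuousOn A (Icc 0 T) := by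
    intro t₀ ht₀
    refine ((schwartz_withSeminorms ℝ E F).tendsto_nhds _ _).2 fun ⟨k, n⟩ ε hε => ?_
    obtain ⟨C, hC⟩ := hA (1 / 2) (by norm_num) k n
    have hc : Continuous fun t : ℝ => C * |t - t₀| ^ (1 / 2 : ℝ) :=
      continuous_const.mul (Continuous.rpow_const (by fun_prop) fun _ => Or.inr (by norm_num))
    have ht := (hc.tendsto t₀).mono_left (nhdsWithin_le_nhds (s := Icc 0 T))
    rw [sub_self, abs_zero, Real.zero_rpow (by norm_num), mul_zero] at ht
    filter_upwards [ht.eventually_lt_const hε, self_mem_nhdsWithin] with t htε htT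
    refine lt_of_le_of_lt ?_ htε
    rw [schwartzSeminormFamily_apply]
    rcases le_total t₀ t with h | h
    · rw [abs_of_nonneg (sub_nonneg.2 h)]
      exact hC t₀ t ht₀.1 h htT.2
    · rw [abs_of_nonpos (sub_nonpos.2 h), neg_sub, map_sub_rev]
      exact hC t t₀ htT.1 h ht₀.2
  rintro ⟨s₀, t₀⟩ ⟨hs₀, hst₀, ht₀⟩
  simp only at hs₀ hst₀ ht₀
  rcases hst₀.eq_or_lt with rfl | hlt
  · rw [ContinuousWithinAt, sub_self (A _), smul_zero]
    refine ((schwartz_withSeminorms ℝ E F).tendsto_nhds _ _).2 fun ⟨k, n⟩ ε hε => ?_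
    have hγ' : (1 + γ) / 2 ∈ Ioo (0 : ℝ) 1 := ⟨by linarith [hγ.1], by linarith [hγ.2]⟩
    have hpos : 0 < (1 + γ) / 2 - γ := by linarith [hγ.2]
    obtain ⟨C, hC⟩ := hA _ hγ' k n
    have hc : Continuous fun q : ℝ × ℝ => C * (q.2 - q.1) ^ ((1 + γ) / 2 - γ) :=
      continuous_const.mul (Continuous.rpow_const (by fun_prop) fun _ => Or.inr hpos.le)
    have ht := (hc.tendsto (s₀, s₀)).mono_left
      (nhdsWithin_le_nhds (s := {q | 0 ≤ q.1 ∧ q.1 ≤ q.2 ∧ q.2 ≤ T}))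
    rw [sub_self, Real.zero_rpow hpos.ne', mul_zero] at ht
    filter_upwards [ht.eventually_lt_const hε, self_mem_nhdsWithin] with q hqε hq
    obtain ⟨s, t⟩ := q
    obtain ⟨hs, hst, htT⟩ := hq
    simp only at hs hst htT hqε
    rw [sub_zero, schwartzSeminormFamily_apply, map_smul_eq_mul]
    rcases hst.eq_or_lt with rfl | hlt
    · simpa using hε
    · have hd : 0 < t - s := sub_pos.2 hlt
      refine lt_of_le_of_lt ?_ hqε
      change ‖(t - s) ^ (-γ)‖ * SchwartzMap.seminorm ℝ k n (A t - A s) ≤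
        C * (t - s) ^ ((1 + γ) / 2 - γ)
      rw [Real.norm_of_nonneg (by positivity), sub_eq_neg_add ((1 + γ) / 2) γ, Real.rpow_add hd]
      calc (t - s) ^ (-γ) * SchwartzMap.seminorm ℝ k n (A t - A s)
          ≤ (t - s) ^ (-γ) * (C * (t - s) ^ ((1 + γ) / 2)) := by
            gcongr
            exact hC s t hs hst htT
        _ = _ := by ring
  · have h1 : ContinuousWithinAt (fun q : ℝ × ℝ => A q.1)
        {q | 0 ≤ q.1 ∧ q.1 ≤ q.2 ∧ q.2 ≤ T} (s₀, t₀) :=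
      ContinuousWithinAt.comp (t := Icc 0 T) (g := A) (f := Prod.fst)
        (hAcont s₀ ⟨hs₀, hst₀.trans ht₀⟩) continuous_fst.continuousWithinAt
        fun _ hq => ⟨hq.1, hq.2.1.trans hq.2.2⟩
    have h2 : ContinuousWithinAt (fun q : ℝ × ℝ => A q.2)
        {q | 0 ≤ q.1 ∧ q.1 ≤ q.2 ∧ q.2 ≤ T} (s₀, t₀) :=
      ContinuousWithinAt.comp (t := Icc 0 T) (g := A) (f := Prod.snd)
        (hAcont t₀ ⟨hs₀.trans hst₀, ht₀⟩) continuous_snd.continuousWithinAt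
        fun _ hq => ⟨hq.1.trans hq.2.1, hq.2.2⟩
    have h3 : ContinuousAt (fun q : ℝ × ℝ => (q.2 - q.1) ^ (-γ)) (s₀, t₀) :=
      ContinuousAt.rpow_const (by fun_prop) (Or.inl (sub_pos.2 hlt).ne')
    exact h3.continuousWithinAt.smul (h2.sub h1)

end Increments

end SchwartzMap

theorem isCompact_ordered_pairs (T : ℝ) :
    IsCompact {q : ℝ × ℝ | 0 ≤ q.1 ∧ q.1 ≤ q.2 ∧ q.2 ≤ T} := by
  have hsq : IsCompact (Icc (0 : ℝ) T ×ˢ Icc (0 : ℝ) T) := isCompact_Icc.prod isCompact_Icc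
  refine hsq.of_isClosed_subset ?_ fun q hq =>
    ⟨⟨hq.1, hq.2.1.trans hq.2.2⟩, ⟨hq.1.trans hq.2.1, hq.2.2⟩⟩
  exact (isClosed_le continuous_const continuous_fst).inter
    ((isClosed_le continuous_fst continuous_snd).inter
      (isClosed_le continuous_snd continuous_const))

/-- **Convergence of averaging operators along convergent sequences of tempered distributions.**
Let `T > 0` and let `ℓ : [0,T] → C_c^∞(ℝ^d)` be supported in one fixed compact set with, for
every `γ ∈ (0,1)` and every derivative order, a bound `‖∂^α(ℓ_t−ℓ_s)‖_∞ ≤ C|t−s|^γ`; package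
the translated increments `z ↦ (ℓ_t−ℓ_s)(z−x)` as Schwartz functions `Lst s t x` and set
`T_{s,t}b(x) := b (Lst s t x)`.  Let `(b_n)` be tempered distributions converging to `b` in
`S'(ℝ^d)` (i.e. `⟨b_n, φ⟩ → ⟨b, φ⟩` for every Schwartz `φ`).  Then there is `λ ≥ 0` such that
for every `γ ∈ (0,1)` and every derivative order `k`,
`sup_{0≤s<t≤T} sup_x (1+|x|²)^{−λ/2} |t−s|^{−γ} |∂^k (T_{s,t}b_n − T_{s,t}b)(x)| → 0`. -/
theorem stmt_15 {d : ℕ} (T : ℝ) (hT : 0 < T)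
    (ℓ : ℝ → Euc d → ℝ)
    (hsmooth : ∀ t ∈ Set.Icc (0:ℝ) T, ContDiff ℝ (⊤:ℕ∞) (ℓ t))
    (hsupp : ∃ K : Set (Euc d), IsCompact K ∧ ∀ t ∈ Set.Icc (0:ℝ) T, tsupport (ℓ t) ⊆ K)
    (hHol : ∀ γ ∈ Set.Ioo (0:ℝ) 1, ∀ n : ℕ, ∃ C : ℝ, ∀ s t : ℝ, 0 ≤ s → s ≤ t → t ≤ T →
      ∀ x : Euc d, ‖iteratedFDeriv ℝ n (fun z => ℓ t z - ℓ s z) x‖ ≤ C * (t - s) ^ γ)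
    (Lst : ℝ → ℝ → Euc d → SchwartzMap (Euc d) ℝ)
    (hLst : ∀ s t x z, Lst s t x z = ℓ t (z - x) - ℓ s (z - x))
    (bseq : ℕ → (SchwartzMap (Euc d) ℝ →L[ℝ] Euc d))
    (b : SchwartzMap (Euc d) ℝ →L[ℝ] Euc d)
    (hconv : ∀ φ : SchwartzMap (Euc d) ℝ, Tendsto (fun n => bseq n φ) atTop (nhds (b φ))) :
    ∃ lam : ℝ, 0 ≤ lam ∧ ∀ γ ∈ Set.Ioo (0:ℝ) 1, ∀ k : ℕ,
      ∀ ε : ℝ, 0 < ε → ∃ N : ℕ, ∀ n ≥ N, ∀ s t : ℝ, 0 ≤ s → s < t → t ≤ T → ∀ x : Euc d,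
        ‖iteratedFDeriv ℝ k (fun x' => bseq n (Lst s t x') - b (Lst s t x')) x‖
          ≤ ε * (1 + ‖x‖ ^ 2) ^ (lam/2) * (t - s) ^ γ := by
  set u : ℕ → 𝓢(Euc d, ℝ) →L[ℝ] Euc d := fun n => bseq n - b
  have hu : ∀ φ, Tendsto (fun n => u n φ) atTop (𝓝 0) := fun φ => by
    have h := (hconv φ).sub_const (b φ)
    rw [sub_self] at h
    exact h
  have hequi := SchwartzMap.uniformEquicontinuous_of_tendsto fun φ => ⟨0, hu φ⟩
  obtain ⟨S, C, hC, hbound⟩ := SchwartzMap.exists_forall_norm_le_sup_seminorm hequi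
  set m := S.sup Prod.fst
  have hm : ∀ q ∈ S, q.1 ≤ m := fun q hq => Finset.le_sup (f := Prod.fst) hq
  set A : ℝ → 𝓢(Euc d, ℝ) := fun t => Lst 0 t 0
  have hA_apply (s t : ℝ) (z : Euc d) : (A t - A s) z = ℓ t z - ℓ s z := by
    simp [A, hLst]
  have hLA (s t : ℝ) (x : Euc d) : Lst s t x = (A t - A s).compSubConstCLM ℝ x := by
    ext z
    rw [SchwartzMap.compSubConstCLM_apply, hA_apply, hLst]
  have hA : ∀ γ ∈ Ioo (0 : ℝ) 1, ∀ k n : ℕ, ∃ C : ℝ, ∀ s t : ℝ, 0 ≤ s → s ≤ t → t ≤ T →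
      SchwartzMap.seminorm ℝ k n (A t - A s) ≤ C * (t - s) ^ γ := by
    intro γ hγ k n
    obtain ⟨K, hK, hKsupp⟩ := hsupp
    obtain ⟨R, hR, hKR⟩ := hK.isBounded.subset_closedBall_lt 0 0
    obtain ⟨C, hC⟩ := hHol γ hγ n
    refine ⟨R ^ k * C, fun s t hs hst ht => ?_⟩
    have hfun : ⇑(A t - A s) = fun z => ℓ t z - ℓ s z := funext (hA_apply s t)
    rw [mul_assoc]
    refine SchwartzMap.seminorm_le_of_tsupport_subset hR.le ?_ (fun x => ?_) k
    · rw [hfun]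
      exact (tsupport_sub (ℓ t) (ℓ s)).trans ((union_subset (hKsupp t ⟨hs.trans hst, ht⟩)
        (hKsupp s ⟨hs, hst.trans ht⟩)).trans hKR)
    · rw [hfun]
      exact hC s t hs hst ht x
  refine ⟨2 * (m + 1 : ℕ), by positivity, fun γ hγ k ε hε => ?_⟩
  have hcont := continuousOn_iff_continuous_domRestrict.1
    (SchwartzMap.continuousOn_rpow_smul_sub hA hγ)
  have : CompactSpace {q : ℝ × ℝ | 0 ≤ q.1 ∧ q.1 ≤ q.2 ∧ q.2 ≤ T} :=
    isCompact_iff_compactSpace.1 (isCompact_ordered_pairs T)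
  obtain ⟨N, hN⟩ := SchwartzMap.exists_forall_norm_iteratedFDeriv_apply_compSubConstCLM_le
    hequi hu hC hbound hm k hcont hε
  refine ⟨N, fun n hn s t hs hst ht x => ?_⟩
  have hd : 0 < t - s := sub_pos.2 hst
  have hNx := hN n hn ⟨(s, t), hs, hst.le, ht⟩ x
  set f : Euc d → Euc d := fun y => u n (((t - s) ^ (-γ) • (A t - A s)).compSubConstCLM ℝ y)
    with hf_def
  have hf : ContDiff ℝ k f := SchwartzMap.contDiff_apply_compSubConstCLM (u n) _ k
  have heq : (fun x' => bseq n (Lst s t x') - b (Lst s t x')) = (t - s) ^ γ • f := by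
    funext y
    have hone : (t - s) ^ γ * (t - s) ^ (-γ) = 1 := by
      rw [← Real.rpow_add hd, add_neg_cancel, Real.rpow_zero]
    rw [hLA, Pi.smul_apply, hf_def]
    simp only [map_smul]
    rw [smul_smul, hone, one_smul]
    rfl
  rw [heq, iteratedFDeriv_const_smul_apply hf.contDiffAt, norm_smul,
    Real.norm_of_nonneg (by positivity), mul_div_cancel_left₀ _ two_ne_zero, Real.rpow_natCast,
    mul_comm]
  gcongr
  exact hNx
end
end

section
/- Let T>0, β,γ∈(0,1) with β+γ>1, let y∈C^β([0,T],ℝ^d) be β-Hölder continuous, and let Y:[0,T]×ℝ^d→ℝ^d be differentiable in the space variable with |Y_{s,t}(x)| + |∇Y_{s,t}(x)| ≤ F(x)|t−s|^γ for all 0≤s≤t≤T and x∈ℝ^d, where Y_{s,t}:=Y_t−Y_s and F:ℝ^d→[0,∞) is locally bounded. Then for every 0≤s≤t≤T the Riemann sums ∑_{[u,v]∈P} Y_{u,v}(y_u) over partitions P of [s,t] converge, as the mesh of P tends to 0, to a limit I_{s,t} =: ∫_s^t Y_{dr}(y_r); the limit is additive (I_{s,u}+I_{u,t}=I_{s,t}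 for s≤u≤t) and satisfies |I_{s,t} − Y_{s,t}(y_s)| ≤ C·(sup_{|x|≤‖y‖_∞}F(x))·‖y‖_{C^β}·|t−s|^{β+γ}, with C depending only on β+γ and T. Moreover I∈C^γ([0,T]) (as a function of t with I_t:=I_{0,t}). -/
noncomputable section
open MeasureTheory Set Filter
open scoped ENNReal NNReal

/-- Convergence of Riemann sums of the germ `Ξ` over partitions of `[s,t]` to the limit `I`, as
the mesh of the partition tends to `0`. -/
def RiemannConv {V : Type*} [NormedAddCommGroup V] (Xi : ℝ → ℝ → V) (s t : ℝ) (I : V) : Prop :=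
  ∀ ε : ℝ, 0 < ε → ∃ δ : ℝ, 0 < δ ∧ ∀ (k : ℕ) (p : ℕ → ℝ),
    p 0 = s → p k = t → (∀ i < k, p i ≤ p (i + 1)) → (∀ i < k, p (i + 1) - p i ≤ δ) →
    ‖(∑ i ∈ Finset.range k, Xi (p i) (p (i + 1))) - I‖ < ε

/-- `y` solves the nonlinear Young equation `y_t = x + ∫_0^t Φ(dr, y_r)` on `[0, T⋆) ∩ [0, T]`:
`y_0 = x`, `y` is `γ`-Hölder continuous on compact subintervals for every exponent `γ ∈ Γ`, and
for every `t < min(T⋆, T)` the Riemann sums `∑_{[u,v]} Φ u v (y u)` over partitions of `[0,t]`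
converge to `y t − x` as the mesh tends to `0`. -/
def IsNLYoungSolution {V : Type*} [NormedAddCommGroup V] (T : ℝ) (Γ : Set ℝ)
    (Φ : ℝ → ℝ → V → V) (x : V) (Tstar : ℝ≥0∞) (y : ℝ → V) : Prop :=
  y 0 = x ∧
  (∀ τ : ℝ, 0 ≤ τ → τ ≤ T → ENNReal.ofReal τ < Tstar →
    ∀ γ ∈ Γ, ∃ C : ℝ, ∀ u ∈ Set.Icc (0:ℝ) τ, ∀ v ∈ Set.Icc (0:ℝ) τ,
      ‖y v - y u‖ ≤ C * |v - u| ^ γ) ∧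
  ∀ t : ℝ, 0 ≤ t → t < T → ENNReal.ofReal t < Tstar →
    RiemannConv (fun u v => Φ u v (y u)) 0 t (y t - x)

/-- The additivity defect of the germ `Ξ` on `[0,T]` is at most `K |t - s| ^ ρ`. -/
def AlmostAdditive {V : Type*} [NormedAddCommGroup V] (Xi : ℝ → ℝ → V) (T ρ K : ℝ) : Prop :=
  ∀ s u t : ℝ, 0 ≤ s → s ≤ u → u ≤ t → t ≤ T →
    ‖Xi s t - Xi s u - Xi u t‖ ≤ K * (t - s) ^ ρ

section Sewing

variable {V : Type*} [NormedAddCommGroup V] {Xi : ℝ → ℝ → V} {T ρ K C : ℝ}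

lemma AlmostAdditive.apply_self (h : AlmostAdditive Xi T ρ K) (hρ : 1 < ρ) {s : ℝ}
    (hs : 0 ≤ s) (hsT : s ≤ T) : Xi s s = 0 := by
  have := h s s s hs le_rfl le_rfl hsT
  rw [sub_self, sub_self, zero_sub, norm_neg, Real.zero_rpow (by linarith), mul_zero] at this
  exact norm_le_zero_iff.1 this

lemma le_of_le_succ_of_le {p : ℕ → ℝ} {k : ℕ} (hp : ∀ i < k, p i ≤ p (i + 1)) {i j : ℕ}
    (hij : i ≤ j) (hj : j ≤ k) : p i ≤ p j := by
  induction j, hij using Nat.le_induction with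
  | base => exact le_rfl
  | succ n _ ih => exact (ih (by omega)).trans (hp n (by omega))

lemma exists_consecutive_le_le {p : ℕ → ℝ} {k : ℕ} {m : ℝ} (hk : 0 < k) (h0 : p 0 ≤ m)
    (hm : m ≤ p k) : ∃ j < k, p j ≤ m ∧ m ≤ p (j + 1) := by
  by_contra! H
  have key : ∀ j, j < k → p j ≤ m := by
    intro j
    induction j with
    | zero => exact fun _ => h0
    | succ n ih => exact fun hn => (H n (by omega) (ih (by omega))).le
  obtain ⟨n, rfl⟩ : ∃ n, k = n + 1 := ⟨k - 1, by omega⟩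
  exact absurd hm (not_le.2 (H n (by omega) (key n (by omega))))

/-- The maximal inequality for Riemann sums of an almost additive germ, proved by splitting the
partition at the interval that contains the midpoint. -/
lemma AlmostAdditive.norm_sub_sum_le (h : AlmostAdditive Xi T ρ K) (hρ : 1 < ρ) (hK : 0 ≤ K)
    (hC0 : 0 ≤ C) (hC : 2 * C * (1 / 2) ^ ρ + 2 ≤ C) (k : ℕ) :
    ∀ p : ℕ → ℝ, (∀ i < k, p i ≤ p (i + 1)) → 0 ≤ p 0 → p k ≤ T →
      ‖Xi (p 0) (p k) - ∑ i ∈ Finset.range k, Xi (p i) (p (i + 1))‖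
        ≤ C * K * (p k - p 0) ^ ρ := by
  induction k using Nat.strong_induction_on with
  | _ k ih =>
  intro p hp h0 hT
  rcases Nat.eq_zero_or_pos k with rfl | hk
  · rw [h.apply_self hρ h0 hT, sub_self, Real.zero_rpow (by linarith)]
    simp
  have h0k : p 0 ≤ p k := le_of_le_succ_of_le hp (Nat.zero_le k) le_rfl
  obtain ⟨j, hjk, hj, hj'⟩ := exists_consecutive_le_le (p := p) (m := (p 0 + p k) / 2) hk
    (by linarith) (by linarith)
  obtain ⟨l, rfl⟩ : ∃ l, k = j + 1 + l := ⟨k - (j + 1), by omega⟩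
  have h1 : p 0 ≤ p j := le_of_le_succ_of_le hp (Nat.zero_le j) (by omega)
  have h2 : p j ≤ p (j + 1) := hp j hjk
  have h3 : p (j + 1) ≤ p (j + 1 + l) := le_of_le_succ_of_le hp (by omega) le_rfl
  have hL := ih j (by omega) p (fun i hi => hp i (by omega)) h0 (by linarith)
  have hR := ih l (by omega) (fun i => p (j + 1 + i)) (fun i hi => hp (j + 1 + i) (by omega))
    (by simp only [add_zero]; linarith) hT
  simp only [add_zero] at hR
  have hA := h (p 0) (p j) (p (j + 1 + l)) h0 h1 (by linarith) hT
  have hB := h (p j) (p (j + 1)) (p (j + 1 + l)) (by linarith) h2 h3 hT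
  have half : ((p (j + 1 + l) - p 0) / 2) ^ ρ = (1 / 2) ^ ρ * (p (j + 1 + l) - p 0) ^ ρ := by
    rw [← Real.mul_rpow (by norm_num) (by linarith)]
    ring_nf
  have hρ0 : 0 ≤ ρ := by linarith
  have eL : (p j - p 0) ^ ρ ≤ (1 / 2) ^ ρ * (p (j + 1 + l) - p 0) ^ ρ := by
    rw [← half]
    exact Real.rpow_le_rpow (by linarith) (by linarith) hρ0
  have eR : (p (j + 1 + l) - p (j + 1)) ^ ρ ≤ (1 / 2) ^ ρ * (p (j + 1 + l) - p 0) ^ ρ := by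
    rw [← half]
    exact Real.rpow_le_rpow (by linarith) (by linarith) hρ0
  have eB : (p (j + 1 + l) - p j) ^ ρ ≤ (p (j + 1 + l) - p 0) ^ ρ :=
    Real.rpow_le_rpow (by linarith) (by linarith) hρ0
  have hD : 0 ≤ (p (j + 1 + l) - p 0) ^ ρ := Real.rpow_nonneg (by linarith) _
  have hCK : 0 ≤ C * K := mul_nonneg hC0 hK
  have split : Xi (p 0) (p (j + 1 + l))
        - ∑ i ∈ Finset.range (j + 1 + l), Xi (p i) (p (i + 1))
      = (Xi (p 0) (p (j + 1 + l)) - Xi (p 0) (p j) - Xi (p j) (p (j + 1 + l)))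
        + (Xi (p j) (p (j + 1 + l)) - Xi (p j) (p (j + 1)) - Xi (p (j + 1)) (p (j + 1 + l)))
        + (Xi (p 0) (p j) - ∑ i ∈ Finset.range j, Xi (p i) (p (i + 1)))
        + (Xi (p (j + 1)) (p (j + 1 + l))
          - ∑ i ∈ Finset.range l, Xi (p (j + 1 + i)) (p (j + 1 + (i + 1)))) := by
    rw [Finset.sum_range_add, Finset.sum_range_succ]
    simp only [add_assoc]
    abel
  rw [split]
  refine norm_add₄_le.trans ?_
  have eL' := mul_le_mul_of_nonneg_left eL hCK
  have eR' := mul_le_mul_of_nonneg_left eR hCK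
  have eB' := mul_le_mul_of_nonneg_left eB hK
  have eC := mul_le_mul_of_nonneg_right hC (mul_nonneg hK hD)
  linarith

/-- Cutting an interval `[a,b]` at `s` changes the germ by at most its additivity defect. -/
lemma AlmostAdditive.norm_min_sub_min_sub_le (h : AlmostAdditive Xi T ρ K) (hρ : 1 < ρ)
    (hK : 0 ≤ K) {a b s t : ℝ} (ha : 0 ≤ a) (hab : a ≤ b) (hs : 0 ≤ s) (hst : s ≤ t)
    (ht : t ≤ T) :
    ‖Xi (min a t) (min b t) - Xi (min a s) (min b s)
        - Xi (min (max a s) t) (min (max b s) t)‖ ≤ K * (b - a) ^ ρ := by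
  have hnn : 0 ≤ K * (b - a) ^ ρ := mul_nonneg hK (Real.rpow_nonneg (by linarith) _)
  have hss := h.apply_self hρ hs (hst.trans ht)
  rcases le_total b s with hbs | hsb
  · have has := hab.trans hbs
    rw [max_eq_right has, max_eq_right hbs, min_eq_left has, min_eq_left hbs,
      min_eq_left (has.trans hst), min_eq_left (hbs.trans hst), min_eq_left hst, hss]
    simpa using hnn
  rcases le_total s a with hsa | has
  · rw [max_eq_left hsa, max_eq_left hsb, min_eq_right hsa, min_eq_right hsb, hss]
    simpa using hnn
  · rw [max_eq_right has, max_eq_left hsb, min_eq_left has, min_eq_right hsb, min_eq_left hst,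
      min_eq_left (has.trans hst)]
    have hsm : s ≤ min b t := le_min hsb hst
    refine (h a s (min b t) ha has hsm ((min_le_right b t).trans ht)).trans ?_
    exact mul_le_mul_of_nonneg_left (Real.rpow_le_rpow (by linarith)
      (by linarith [min_le_left b t]) (by linarith)) hK

/-- The Riemann sum on `[0,t]` of the uniform partition of `[0,T]` into `n` intervals, stopped
at `t`. -/
def uniformSum (Xi : ℝ → ℝ → V) (T : ℝ) (n : ℕ) (t : ℝ) : V :=
  ∑ i ∈ Finset.range n, Xi (min (i * (T / n)) t) (min ((i + 1 : ℕ) * (T / n)) t)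

lemma AlmostAdditive.norm_uniformSum_sub_le (h : AlmostAdditive Xi T ρ K) (hT : 0 < T)
    (hρ : 1 < ρ) (hK : 0 ≤ K) (hC0 : 0 ≤ C) (hC : 2 * C * (1 / 2) ^ ρ + 2 ≤ C) {n : ℕ}
    (hn : 0 < n) {s t : ℝ} (hs : 0 ≤ s) (hst : s ≤ t) (ht : t ≤ T) :
    ‖uniformSum Xi T n t - uniformSum Xi T n s - Xi s t‖
      ≤ C * K * (t - s) ^ ρ + n * (K * (T / n) ^ ρ) := by
  have hn' : (0 : ℝ) < n := by exact_mod_cast hn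
  have hTn : 0 < T / n := div_pos hT hn'
  have step : ∀ i : ℕ, (i : ℝ) * (T / n) ≤ (i + 1 : ℕ) * (T / n) := fun i => by
    push_cast
    nlinarith
  set q : ℕ → ℝ := fun i => min (max (i * (T / n)) s) t with hq
  have q0 : q 0 = s := by simp [hq, hs, hst]
  have qn : q n = t := by
    have : (n : ℝ) * (T / n) = T := by field_simp
    simp [hq, this, ht]
  have hsum := h.norm_sub_sum_le hρ hK hC0 hC n q
    (fun i _ => min_le_min_right _ (max_le_max_right _ (step i))) (q0.symm ▸ hs) (qn.symm ▸ ht)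
  rw [q0, qn] at hsum
  have hcut : ‖uniformSum Xi T n t - uniformSum Xi T n s
      - ∑ i ∈ Finset.range n, Xi (q i) (q (i + 1))‖ ≤ n * (K * (T / n) ^ ρ) := by
    rw [uniformSum, uniformSum, ← Finset.sum_sub_distrib, ← Finset.sum_sub_distrib]
    refine (norm_sum_le_of_le (Finset.range n) (fun i _ =>
      h.norm_min_sub_min_sub_le hρ hK (a := i * (T / n)) (b := (i + 1 : ℕ) * (T / n))
        (by positivity) (step i) hs hst ht)).trans (le_of_eq ?_)
    have : ∀ i : ℕ, ((i + 1 : ℕ) : ℝ) * (T / n) - i * (T / n) = T / n := fun i => by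
      push_cast
      ring
    simp only [this, Finset.sum_const, Finset.card_range, nsmul_eq_mul]
  calc ‖uniformSum Xi T n t - uniformSum Xi T n s - Xi s t‖
      = ‖(uniformSum Xi T n t - uniformSum Xi T n s
            - ∑ i ∈ Finset.range n, Xi (q i) (q (i + 1)))
          - (Xi s t - ∑ i ∈ Finset.range n, Xi (q i) (q (i + 1)))‖ := by
        congr 1
        abel
    _ ≤ _ := (norm_sub_le _ _).trans (by linarith)

lemma tendsto_nat_mul_div_rpow (hT : 0 < T) (hρ : 1 < ρ) (K : ℝ) :
    Tendsto (fun n : ℕ => (n : ℝ) * (K * (T / n) ^ ρ)) atTop (nhds 0) := by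
  have h := ((tendsto_rpow_neg_atTop (sub_pos.2 hρ)).comp
    tendsto_natCast_atTop_atTop).const_mul (K * T ^ ρ)
  rw [mul_zero] at h
  refine h.congr' ?_
  filter_upwards [eventually_gt_atTop 0] with n hn
  have hn' : (0 : ℝ) < n := by exact_mod_cast hn
  rw [Function.comp_apply, Real.div_rpow hT.le hn'.le, neg_sub, Real.rpow_sub hn', Real.rpow_one]
  ring

/-- The sewing lemma: an almost additive germ is approximated by the increments of a path. -/
lemma AlmostAdditive.exists_sewing [ProperSpace V] (h : AlmostAdditive Xi T ρ K) (hT : 0 < T)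
    (hρ : 1 < ρ) (hK : 0 ≤ K) (hC0 : 0 ≤ C) (hC : 2 * C * (1 / 2) ^ ρ + 2 ≤ C) :
    ∃ J : ℝ → V, ∀ K' : ℝ, 0 ≤ K' → AlmostAdditive Xi T ρ K' →
      ∀ s t : ℝ, 0 ≤ s → s ≤ t → t ≤ T → ‖J t - J s - Xi s t‖ ≤ C * K' * (t - s) ^ ρ := by
  have hlim (t : ℝ) : ∃ z : V, 0 ≤ t → t ≤ T →
      Tendsto (fun n => uniformSum Xi T n t) (hyperfilter ℕ : Filter ℕ) (nhds z) := by
    by_cases ht : 0 ≤ t ∧ t ≤ T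
    swap
    · exact ⟨0, fun h1 h2 => absurd ⟨h1, h2⟩ ht⟩
    have hzero (n : ℕ) : uniformSum Xi T n 0 = 0 := by
      refine Finset.sum_eq_zero fun i _ => ?_
      rw [min_eq_right (by positivity), min_eq_right (by positivity)]
      exact h.apply_self hρ le_rfl hT.le
    have hbdd : ∀ᶠ n in (hyperfilter ℕ : Filter ℕ),
        uniformSum Xi T n t ∈ Metric.closedBall (Xi 0 t) (C * K * (t - 0) ^ ρ + 1) := by
      refine Nat.hyperfilter_le_atTop ?_
      filter_upwards [(tendsto_nat_mul_div_rpow hT hρ K).eventually_le_const one_pos,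
        eventually_gt_atTop 0] with n hn hpos
      have := h.norm_uniformSum_sub_le hT hρ hK hC0 hC hpos le_rfl ht.1 ht.2
      rw [hzero, sub_zero] at this
      rw [Metric.mem_closedBall, dist_eq_norm]
      linarith
    obtain ⟨z, -, hz⟩ := (isCompact_closedBall (Xi 0 t) (C * K * (t - 0) ^ ρ + 1)
      ).ultrafilter_le_nhds ((hyperfilter ℕ).map fun n => uniformSum Xi T n t)
      (le_principal_iff.2 hbdd)
    exact ⟨z, fun _ _ => hz⟩
  choose J hJ using hlim
  refine ⟨J, fun K' hK' h' s t hs hst ht => ?_⟩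
  have hleft := (((hJ t (hs.trans hst) ht).sub (hJ s hs (hst.trans ht))).sub_const (Xi s t)).norm
  have hright := ((tendsto_nat_mul_div_rpow hT hρ K').const_add
    (C * K' * (t - s) ^ ρ)).mono_left Nat.hyperfilter_le_atTop
  rw [add_zero] at hright
  refine le_of_tendsto_of_tendsto hleft hright (Nat.hyperfilter_le_atTop ?_)
  filter_upwards [eventually_gt_atTop 0] with n hn
  exact h'.norm_uniformSum_sub_le hT hρ hK' hC0 hC hn hs hst ht

/-- Riemann sums of a germ that is approximated by increments with an error of order `ρ > 1`
converge to the increment. -/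
lemma riemannConv_of_norm_sub_le {J : ℝ → V} {M s t : ℝ} (hρ : 1 < ρ) (hM : 0 ≤ M)
    (hst : s ≤ t)
    (h : ∀ u v : ℝ, s ≤ u → u ≤ v → v ≤ t → ‖J v - J u - Xi u v‖ ≤ M * (v - u) ^ ρ) :
    RiemannConv Xi s t (J t - J s) := by
  intro ε hε
  have hden : 0 < M * (t - s) + 1 := by
    have := mul_nonneg hM (sub_nonneg.2 hst)
    linarith
  have hρ' : 0 < ρ - 1 := sub_pos.2 hρ
  refine ⟨(ε / (M * (t - s) + 1)) ^ (ρ - 1)⁻¹, by positivity, fun k p h0 hk hp hmesh => ?_⟩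
  set η := ε / (M * (t - s) + 1) with hη
  have hη0 : 0 < η := div_pos hε hden
  have hterm : ∀ i ∈ Finset.range k,
      ‖Xi (p i) (p (i + 1)) - (J (p (i + 1)) - J (p i))‖ ≤ M * η * (p (i + 1) - p i) := by
    intro i hi
    have hik := Finset.mem_range.1 hi
    have hle := hp i hik
    have h1 : s ≤ p i := h0 ▸ le_of_le_succ_of_le hp (Nat.zero_le i) hik.le
    have h2 : p (i + 1) ≤ t := hk ▸ le_of_le_succ_of_le hp (show i + 1 ≤ k from hik) le_rfl
    rw [norm_sub_rev]
    refine (h _ _ h1 hle h2).trans ?_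
    rw [mul_assoc]
    refine mul_le_mul_of_nonneg_left ?_ hM
    have hd : 0 ≤ p (i + 1) - p i := sub_nonneg.2 hle
    have hpow : (p (i + 1) - p i) ^ (ρ - 1) ≤ η := by
      refine (Real.rpow_le_rpow hd (hmesh i hik) hρ'.le).trans (le_of_eq ?_)
      rw [← Real.rpow_mul hη0.le, inv_mul_cancel₀ hρ'.ne', Real.rpow_one]
    calc (p (i + 1) - p i) ^ ρ = (p (i + 1) - p i) ^ (ρ - 1) * (p (i + 1) - p i) := by
          rw [← Real.rpow_add_one' hd (by linarith), sub_add_cancel]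
      _ ≤ η * (p (i + 1) - p i) := mul_le_mul_of_nonneg_right hpow hd
  have htel : J t - J s = ∑ i ∈ Finset.range k, (J (p (i + 1)) - J (p i)) := by
    rw [Finset.sum_range_sub (fun i => J (p i)), h0, hk]
  rw [htel, ← Finset.sum_sub_distrib]
  refine (norm_sum_le_of_le _ hterm).trans_lt ?_
  rw [← Finset.mul_sum, Finset.sum_range_sub p, h0, hk]
  have : η * (M * (t - s) + 1) = ε := div_mul_cancel₀ ε hden.ne'
  linarith

end Sewing

lemma exists_forall_norm_le_le {E : Type*} [NormedAddCommGroup E] [ProperSpace E] {F : E → ℝ}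
    (hF : ∀ x : E, ∃ r : ℝ, 0 < r ∧ ∃ M : ℝ, ∀ x', ‖x' - x‖ ≤ r → F x' ≤ M) (R : ℝ) :
    ∃ M : ℝ, ∀ x : E, ‖x‖ ≤ R → F x ≤ M := by
  obtain ⟨M, hM⟩ : ∃ M : ℝ, ∀ x ∈ Metric.closedBall (0 : E) R, F x ≤ M := by
    refine (isCompact_closedBall (0 : E) R).induction_on
      (p := fun S => ∃ M : ℝ, ∀ x ∈ S, F x ≤ M) ⟨0, by simp⟩
      (fun S S' hSS' ⟨M, hM⟩ => ⟨M, fun x hx => hM x (hSS' hx)⟩)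
      (fun S S' ⟨M, hM⟩ ⟨M', hM'⟩ => ⟨max M M', ?_⟩) (fun x _ => ?_)
    · rintro x (hx | hx)
      · exact (hM x hx).trans (le_max_left _ _)
      · exact (hM' x hx).trans (le_max_right _ _)
    · obtain ⟨r, hr, M, hM⟩ := hF x
      exact ⟨Metric.closedBall x r, mem_nhdsWithin_of_mem_nhds (Metric.closedBall_mem_nhds x hr), M,
        fun x' hx' => hM x' (by rwa [← dist_eq_norm])⟩
  exact ⟨M, fun x hx => hM x (by simpa using hx)⟩

/-- The germ `Y_{s,t}(y_s)` of the nonlinear Young integral is almost additive. -/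
lemma almostAdditive_nonlinearYoung {E : Type*} [NormedAddCommGroup E] [NormedSpace ℝ E]
    {T β γ My Hy MF : ℝ} (hβ : 0 < β) (hγ : 0 < γ) {y : ℝ → E} {Y : ℝ → E → E} {F : E → ℝ}
    (hY : ∀ t, Differentiable ℝ (Y t))
    (hYF : ∀ s t : ℝ, 0 ≤ s → s ≤ t → t ≤ T → ∀ x : E,
      ‖Y t x - Y s x‖ + ‖fderiv ℝ (fun x' => Y t x' - Y s x') x‖ ≤ F x * (t - s) ^ γ)
    (hMy : ∀ t ∈ Set.Icc (0 : ℝ) T, ‖y t‖ ≤ My)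
    (hHy : ∀ s ∈ Set.Icc (0 : ℝ) T, ∀ t ∈ Set.Icc (0 : ℝ) T, ‖y t - y s‖ ≤ Hy * |t - s| ^ β)
    (hMF : ∀ x : E, ‖x‖ ≤ My → F x ≤ MF) (hMF0 : 0 ≤ MF) (hHy0 : 0 ≤ Hy) :
    AlmostAdditive (fun u v => Y v (y u) - Y u (y u)) T (β + γ) (MF * Hy) := by
  intro s u t hs hsu hut ht
  have hsI : s ∈ Set.Icc (0 : ℝ) T := ⟨hs, by linarith⟩
  have huI : u ∈ Set.Icc (0 : ℝ) T := ⟨by linarith, by linarith⟩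
  have hmean : ‖(Y t (y s) - Y u (y s)) - (Y t (y u) - Y u (y u))‖
      ≤ MF * (t - u) ^ γ * ‖y s - y u‖ := by
    refine (convex_closedBall (0 : E) My).norm_image_sub_le_of_norm_fderiv_le (𝕜 := ℝ)
      (f := fun x' => Y t x' - Y u x') (fun x _ => ((hY t) x).sub ((hY u) x)) (fun x hx => ?_)
      (by simpa using hMy u huI) (by simpa using hMy s hsI)
    have hle := hYF u t huI.1 hut ht x
    have hFx := mul_le_mul_of_nonneg_right (hMF x (by simpa using hx))
      (Real.rpow_nonneg (sub_nonneg.2 hut) γ)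
    linarith [norm_nonneg (Y t x - Y u x)]
  have hy : ‖y s - y u‖ ≤ Hy * (t - s) ^ β := by
    rw [norm_sub_rev]
    refine (hHy s hsI u huI).trans ?_
    rw [abs_of_nonneg (sub_nonneg.2 hsu)]
    exact mul_le_mul_of_nonneg_left
      (Real.rpow_le_rpow (by linarith) (by linarith) hβ.le) hHy0
  have htu : (t - u) ^ γ ≤ (t - s) ^ γ := Real.rpow_le_rpow (by linarith) (by linarith) hγ.le
  have hts : 0 ≤ t - s := by linarith
  calc ‖Y t (y s) - Y s (y s) - (Y u (y s) - Y s (y s)) - (Y t (y u) - Y u (y u))‖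
      = ‖(Y t (y s) - Y u (y s)) - (Y t (y u) - Y u (y u))‖ := by
        congr 1
        abel
    _ ≤ MF * (t - u) ^ γ * ‖y s - y u‖ := hmean
    _ ≤ MF * (t - s) ^ γ * (Hy * (t - s) ^ β) := by gcongr
    _ = MF * Hy * (t - s) ^ (β + γ) := by
        rw [Real.rpow_add_of_nonneg hts hβ.le hγ.le]
        ring

lemma exists_sewing_constant {ρ : ℝ} (hρ : 1 < ρ) :
    ∃ C : ℝ, 0 < C ∧ 2 * C * (1 / 2) ^ ρ + 2 ≤ C := by
  have hlt : ((1 : ℝ) / 2) ^ ρ < 1 / 2 := by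
    have := Real.rpow_lt_rpow_of_exponent_gt (x := (1 : ℝ) / 2) (by norm_num) (by norm_num) hρ
    rwa [Real.rpow_one] at this
  have hpos : 0 < 1 - 2 * ((1 : ℝ) / 2) ^ ρ := by linarith
  refine ⟨2 / (1 - 2 * (1 / 2) ^ ρ), by positivity, le_of_eq ?_⟩
  generalize ((1 : ℝ) / 2) ^ ρ = a at *
  field_simp
  ring

/-- **The nonlinear Young integral (sewing lemma construction).**
Let `T > 0` and `β, γ ∈ (0,1)` with `β + γ = ρ > 1`.  There is a constant `C > 0`,
depending only on `ρ = β + γ` and `T`, such that for every `β`-Hölder path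
`y : [0,T] → ℝ^d` and every field `Y`, differentiable in space with
`|Y_{s,t}(x)| + |∇Y_{s,t}(x)| ≤ F(x)|t−s|^γ` for a locally bounded `F`, the Riemann sums
`∑ Y_{u,v}(y_u)` over partitions of `[s,t]` converge to a limit `I_{s,t} = ∫_s^t Y_{dr}(y_r)`
as the mesh tends to `0`; the limit is additive and satisfies
`|I_{s,t} − Y_{s,t}(y_s)| ≤ C·(sup_{|x|≤‖y‖_∞} F(x))·‖y‖_{C^β}·|t−s|^{β+γ}`, and
`t ↦ I_{0,t}` is `γ`-Hölder on `[0,T]`. -/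
theorem stmt_16 (T ρ : ℝ) (hT : 0 < T) (hρ : 1 < ρ) :
    ∃ C : ℝ, 0 < C ∧
    ∀ β γ : ℝ, β ∈ Set.Ioo (0:ℝ) 1 → γ ∈ Set.Ioo (0:ℝ) 1 → β + γ = ρ →
    ∀ (d : ℕ) (y : ℝ → Euc d) (Y : ℝ → Euc d → Euc d) (F : Euc d → ℝ),
    (∃ Cy : ℝ, ∀ s ∈ Set.Icc (0:ℝ) T, ∀ t ∈ Set.Icc (0:ℝ) T,
      ‖y t - y s‖ ≤ Cy * |t - s| ^ β) →
    (∀ t, Differentiable ℝ (Y t)) →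
    (∀ x : Euc d, ∃ r : ℝ, 0 < r ∧ ∃ M : ℝ, ∀ x', ‖x' - x‖ ≤ r → F x' ≤ M) →
    (∀ s t : ℝ, 0 ≤ s → s ≤ t → t ≤ T → ∀ x : Euc d,
      ‖Y t x - Y s x‖ + ‖fderiv ℝ (fun x' => Y t x' - Y s x') x‖ ≤ F x * (t - s) ^ γ) →
    ∃ I : ℝ → ℝ → Euc d,
      (∀ s t : ℝ, 0 ≤ s → s ≤ t → t ≤ T →
        RiemannConv (fun u v => Y v (y u) - Y u (y u)) s t (I s t)) ∧
      (∀ s u t : ℝ, 0 ≤ s → s ≤ u → u ≤ t → t ≤ T → I s u + I u t = I s t) ∧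
      (∀ My Hy MF : ℝ,
        (∀ t ∈ Set.Icc (0:ℝ) T, ‖y t‖ ≤ My) →
        (∀ s ∈ Set.Icc (0:ℝ) T, ∀ t ∈ Set.Icc (0:ℝ) T, ‖y t - y s‖ ≤ Hy * |t - s| ^ β) →
        (∀ x : Euc d, ‖x‖ ≤ My → F x ≤ MF) →
        ∀ s t : ℝ, 0 ≤ s → s ≤ t → t ≤ T →
          ‖I s t - (Y t (y s) - Y s (y s))‖ ≤ C * MF * Hy * (t - s) ^ (β + γ)) ∧
      (∃ C' : ℝ, ∀ s ∈ Set.Icc (0:ℝ) T, ∀ t ∈ Set.Icc (0:ℝ) T,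
        ‖I 0 t - I 0 s‖ ≤ C' * |t - s| ^ γ) := by
  obtain ⟨C, hC0, hC⟩ := exists_sewing_constant hρ
  refine ⟨C, hC0, ?_⟩
  rintro β γ ⟨hβ, -⟩ ⟨hγ, -⟩ rfl d y Y F ⟨Cy, hCy⟩ hY hF hYF
  have h0I : (0 : ℝ) ∈ Set.Icc (0 : ℝ) T := ⟨le_rfl, hT.le⟩
  have hTI : T ∈ Set.Icc (0 : ℝ) T := ⟨hT.le, le_rfl⟩
  have hHy0 : ∀ Hy : ℝ, (∀ s ∈ Set.Icc (0:ℝ) T, ∀ t ∈ Set.Icc (0:ℝ) T,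
      ‖y t - y s‖ ≤ Hy * |t - s| ^ β) → 0 ≤ Hy := fun Hy h => by
    have := (norm_nonneg _).trans (h 0 h0I T hTI)
    rw [sub_zero, abs_of_pos hT] at this
    exact nonneg_of_mul_nonneg_left this (Real.rpow_pos_of_pos hT β)
  have hFnn : ∀ x, 0 ≤ F x := fun x => by
    have := (add_nonneg (norm_nonneg _) (norm_nonneg _)).trans (hYF 0 T le_rfl hT.le le_rfl x)
    rw [sub_zero] at this
    exact nonneg_of_mul_nonneg_left this (Real.rpow_pos_of_pos hT γ)
  have hMF0 : ∀ My MF : ℝ, (∀ t ∈ Set.Icc (0:ℝ) T, ‖y t‖ ≤ My) →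
      (∀ x : Euc d, ‖x‖ ≤ My → F x ≤ MF) → 0 ≤ MF := fun My MF h h' =>
    (hFnn (y 0)).trans (h' _ (h 0 h0I))
  have hCy0 := hHy0 Cy hCy
  obtain ⟨R, hR⟩ : ∃ R : ℝ, ∀ t ∈ Set.Icc (0:ℝ) T, ‖y t‖ ≤ R := by
    refine ⟨Cy * T ^ β + ‖y 0‖, fun t ht => ?_⟩
    have h1 := hCy 0 h0I t ht
    rw [sub_zero, abs_of_nonneg ht.1] at h1
    have h2 := mul_le_mul_of_nonneg_left (Real.rpow_le_rpow ht.1 ht.2 hβ.le) hCy0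
    have h3 := norm_sub_norm_le (y t) (y 0)
    linarith
  obtain ⟨M, hM⟩ := exists_forall_norm_le_le hF R
  have hM0 := hMF0 R M hR hM
  have hK0 : 0 ≤ M * Cy := mul_nonneg hM0 hCy0
  have hadd := almostAdditive_nonlinearYoung hβ hγ hY hYF hR hCy hM hM0 hCy0
  obtain ⟨J, hJ⟩ := hadd.exists_sewing hT hρ hK0 hC0.le hC
  refine ⟨fun s t => J t - J s, fun s t hs hst ht => ?_, fun s u t _ _ _ _ => sub_add_sub_cancel' _ _ _,
    fun My Hy MF hMy hHy hMF s t hs hst ht => ?_, M + C * (M * Cy) * T ^ β, ?_⟩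
  · exact riemannConv_of_norm_sub_le hρ (mul_nonneg hC0.le hK0) hst fun u v hu huv hv =>
      hJ _ hK0 hadd u v (hs.trans hu) huv (hv.trans ht)
  · have h1 := hHy0 Hy hHy
    have h2 := hMF0 My MF hMy hMF
    rw [mul_assoc C MF Hy]
    exact hJ _ (mul_nonneg h2 h1)
      (almostAdditive_nonlinearYoung hβ hγ hY hYF hMy hHy hMF h2 h1) s t hs hst ht
  · have key : ∀ s t : ℝ, 0 ≤ s → s ≤ t → t ≤ T →
        ‖J t - J s‖ ≤ (M + C * (M * Cy) * T ^ β) * (t - s) ^ γ := by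
      intro s t hs hst ht
      have hts : 0 ≤ t - s := sub_nonneg.2 hst
      have hγ0 := Real.rpow_nonneg hts γ
      have h1 := hJ _ hK0 hadd s t hs hst ht
      have h2 : ‖Y t (y s) - Y s (y s)‖ ≤ M * (t - s) ^ γ := by
        have h3 := hYF s t hs hst ht (y s)
        have h4 := mul_le_mul_of_nonneg_right (hM (y s) (hR s ⟨hs, hst.trans ht⟩)) hγ0
        linarith [norm_nonneg (fderiv ℝ (fun x' => Y t x' - Y s x') (y s))]
      have h5 : (t - s) ^ (β + γ) ≤ T ^ β * (t - s) ^ γ := by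
        rw [Real.rpow_add_of_nonneg hts hβ.le hγ.le]
        exact mul_le_mul_of_nonneg_right
          (Real.rpow_le_rpow hts (by linarith) hβ.le) hγ0
      have h6 := mul_le_mul_of_nonneg_left h5 (mul_nonneg hC0.le hK0)
      have h7 := norm_sub_norm_le (J t - J s) (Y t (y s) - Y s (y s))
      linarith
    intro s hs t ht
    have hsimp : J t - J 0 - (J s - J 0) = J t - J s := by abel
    simp only [hsimp]
    rcases le_total s t with hst | hts
    · rw [abs_of_nonneg (sub_nonneg.2 hst)]
      exact key s t hs.1 hst ht.2
    · rw [abs_sub_comm, abs_of_nonneg (sub_nonneg.2 hts), norm_sub_rev]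
      exact key t s ht.1 hts hs.2
end
end

section
/- Let T>0, β,γ∈(0,1) with β+γ>1, y∈C^β([0,T],ℝ^d), and let Y,Ỹ:[0,T]×ℝ^d→ℝ^d both be differentiable in space with |Y_{s,t}(x)|+|∇Y_{s,t}(x)| ≤ F(x)|t−s|^γ and |Ỹ_{s,t}(x)|+|∇Ỹ_{s,t}(x)| ≤ F̃(x)|t−s|^γ for locally bounded F,F̃. Then the nonlinear Young integrals satisfy, for all 0≤s≤t≤T, |∫_s^t Y_{dr}(y_r) − ∫_s^t Ỹ_{dr}(y_r)| ≤ C (1+‖y‖_{C^β}) ‖Y−Ỹ‖_{γ,1,B_K}, where K=‖y‖_∞, C depends only on β,γ,T, and ‖Y−Ỹ‖_{γ,1,B_K} := sup_{s≠t,|x|≤K} |t−s|^{−γ}|(Y_{s,t}−Ỹ_{s,t})(x)| + sup_{s≠t,|x|≤K} |t−s|^{−γ}|∇(Y_{s,t}−Ỹ_{s,t})(x)|. -/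
noncomputable section
open MeasureTheory Set Filter
open scoped ENNReal NNReal

lemma Finset.sum_range_two_mul {V : Type*} [AddCommMonoid V] (f : ℕ → V) (m : ℕ) :
    ∑ i ∈ Finset.range (2 * m), f i = ∑ i ∈ Finset.range m, (f (2 * i) + f (2 * i + 1)) := by
  induction m with
  | zero => simp
  | succ m ih =>
    rw [show 2 * (m + 1) = 2 * m + 1 + 1 by ring, Finset.sum_range_succ, Finset.sum_range_succ, ih,
      Finset.sum_range_succ, add_assoc]

lemma RiemannConv.sub {V : Type*} [NormedAddCommGroup V] {Xi Xi' : ℝ → ℝ → V} {s t : ℝ} {I I' : V}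
    (h : RiemannConv Xi s t I) (h' : RiemannConv Xi' s t I') :
    RiemannConv (fun u v => Xi u v - Xi' u v) s t (I - I') := by
  intro ε hε
  obtain ⟨δ, hδ, H⟩ := h (ε / 2) (half_pos hε)
  obtain ⟨δ', hδ', H'⟩ := h' (ε / 2) (half_pos hε)
  refine ⟨min δ δ', lt_min hδ hδ', fun k p h0 hk hmono hmesh => ?_⟩
  have h1 := H k p h0 hk hmono fun i hi => (hmesh i hi).trans (min_le_left _ _)
  have h2 := H' k p h0 hk hmono fun i hi => (hmesh i hi).trans (min_le_right _ _)
  rw [Finset.sum_sub_distrib, sub_sub_sub_comm]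
  exact (norm_sub_le _ _).trans_lt (by linarith)

/-- The point with index `i` of the dyadic partition of `[s, t]` into `2 ^ n` intervals. -/
def dyadicPoint (s t : ℝ) (n i : ℕ) : ℝ := s + i * ((t - s) / 2 ^ n)

lemma dyadicPoint_succ_sub (s t : ℝ) (n i : ℕ) :
    dyadicPoint s t n (i + 1) - dyadicPoint s t n i = (t - s) / 2 ^ n := by
  simp only [dyadicPoint]; push_cast; ring

lemma dyadicPoint_two_mul (s t : ℝ) (n i : ℕ) :
    dyadicPoint s t (n + 1) (2 * i) = dyadicPoint s t n i := by
  simp only [dyadicPoint, pow_succ]; push_cast; field_simp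

lemma dyadicPoint_two_pow (s t : ℝ) (n : ℕ) : dyadicPoint s t n (2 ^ n) = t := by
  simp only [dyadicPoint]; push_cast; field_simp; ring

lemma dyadicPoint_mono {s t : ℝ} (hst : s ≤ t) (n : ℕ) : Monotone (dyadicPoint s t n) := by
  refine monotone_nat_of_le_succ fun i => sub_nonneg.1 ?_
  rw [dyadicPoint_succ_sub]
  exact div_nonneg (sub_nonneg.2 hst) (by positivity)

/-- Refining the dyadic partition of level `n` changes the Riemann sum of an almost additive germ
by a geometrically small amount. -/
lemma norm_dyadic_sum_succ_sub_le {V : Type*} [NormedAddCommGroup V] {Xi : ℝ → ℝ → V}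
    {s t θ K : ℝ} (hst : s ≤ t)
    (hXi : ∀ u m v : ℝ, s ≤ u → u ≤ m → m ≤ v → v ≤ t →
      ‖Xi u m + Xi m v - Xi u v‖ ≤ K * (v - u) ^ θ) (n : ℕ) :
    ‖(∑ i ∈ Finset.range (2 ^ (n + 1)),
          Xi (dyadicPoint s t (n + 1) i) (dyadicPoint s t (n + 1) (i + 1)))
        - ∑ i ∈ Finset.range (2 ^ n), Xi (dyadicPoint s t n i) (dyadicPoint s t n (i + 1))‖
      ≤ K * (t - s) ^ θ * ((2 : ℝ) ^ (1 - θ)) ^ n := by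
  rw [pow_succ', Finset.sum_range_two_mul, ← Finset.sum_sub_distrib]
  have hterm : ∀ i ∈ Finset.range (2 ^ n),
      ‖Xi (dyadicPoint s t (n + 1) (2 * i)) (dyadicPoint s t (n + 1) (2 * i + 1))
          + Xi (dyadicPoint s t (n + 1) (2 * i + 1)) (dyadicPoint s t (n + 1) (2 * i + 1 + 1))
          - Xi (dyadicPoint s t n i) (dyadicPoint s t n (i + 1))‖
        ≤ K * ((t - s) / 2 ^ n) ^ θ := by
    intro i hi
    rw [← dyadicPoint_succ_sub s t n i, ← dyadicPoint_two_mul s t n i,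
      ← dyadicPoint_two_mul s t n (i + 1)]
    refine hXi _ _ _ ?_ (dyadicPoint_mono hst _ (by omega)) (dyadicPoint_mono hst _ (by omega)) ?_
    · simpa [dyadicPoint] using dyadicPoint_mono hst (n + 1) (Nat.zero_le (2 * i))
    · exact (dyadicPoint_two_mul s t n (i + 1)).trans_le <|
        (dyadicPoint_mono hst n (Finset.mem_range.1 hi)).trans_eq (dyadicPoint_two_pow s t n)
  refine (norm_sum_le_of_le _ hterm).trans_eq ?_
  rw [Finset.sum_const, Finset.card_range, nsmul_eq_mul,
    Real.div_rpow (sub_nonneg.2 hst) (by positivity), Real.rpow_sub two_pos, Real.rpow_one, div_pow,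
    Real.rpow_pow_comm two_pos.le]
  push_cast
  ring

/-- The sewing estimate: the limit of the Riemann sums of an almost additive germ is close to the
germ itself. -/
lemma RiemannConv.norm_sub_le {V : Type*} [NormedAddCommGroup V] {Xi : ℝ → ℝ → V}
    {s t θ K : ℝ} {I : V} (h : RiemannConv Xi s t I) (hst : s ≤ t) (hθ : 1 < θ) (hK : 0 ≤ K)
    (hXi : ∀ u m v : ℝ, s ≤ u → u ≤ m → m ≤ v → v ≤ t →
      ‖Xi u m + Xi m v - Xi u v‖ ≤ K * (v - u) ^ θ) :
    ‖I - Xi s t‖ ≤ K * (t - s) ^ θ * (1 - (2 : ℝ) ^ (1 - θ))⁻¹ := by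
  set S : ℕ → V := fun n =>
    ∑ i ∈ Finset.range (2 ^ n), Xi (dyadicPoint s t n i) (dyadicPoint s t n (i + 1))
  have hA : 0 ≤ K * (t - s) ^ θ := mul_nonneg hK (Real.rpow_nonneg (sub_nonneg.2 hst) _)
  have hr0 : (0 : ℝ) ≤ 2 ^ (1 - θ) := by positivity
  have hr1 : (2 : ℝ) ^ (1 - θ) < 1 := Real.rpow_lt_one_of_one_lt_of_neg one_lt_two (by linarith)
  have hS0 : S 0 = Xi s t := by simp [S, dyadicPoint]
  have hsum : ∀ n, ‖S n - Xi s t‖ ≤ K * (t - s) ^ θ * (1 - (2 : ℝ) ^ (1 - θ))⁻¹ := by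
    intro n
    rw [← hS0, ← Finset.sum_range_sub]
    refine (norm_sum_le_of_le _ fun n _ => norm_dyadic_sum_succ_sub_le hst hXi n).trans ?_
    rw [← Finset.mul_sum, ← tsum_geometric_of_lt_one hr0 hr1]
    gcongr
    exact (summable_geometric_of_lt_one hr0 hr1).sum_le_tsum _ fun i _ => by positivity
  refine le_of_forall_pos_le_add fun ε hε => ?_
  obtain ⟨δ, hδ, H⟩ := h ε hε
  obtain ⟨n, hn⟩ := pow_unbounded_of_one_lt ((t - s) / δ) (one_lt_two (α := ℝ))
  have hSn : ‖S n - I‖ < ε := by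
    refine H (2 ^ n) (dyadicPoint s t n) (by simp [dyadicPoint]) (dyadicPoint_two_pow s t n)
      (fun i _ => dyadicPoint_mono hst n i.le_succ) fun i _ => ?_
    rw [dyadicPoint_succ_sub, div_le_iff₀ (by positivity), mul_comm]
    exact ((div_lt_iff₀ hδ).1 hn).le
  calc ‖I - Xi s t‖ = ‖(S n - Xi s t) - (S n - I)‖ := by congr 1; abel
    _ ≤ ‖S n - Xi s t‖ + ‖S n - I‖ := _root_.norm_sub_le _ _
    _ ≤ _ := add_le_add (hsum n) hSn.le

/-- **Stability of the nonlinear Young integral.**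
Let `T > 0` and `β, γ ∈ (0,1)` with `β + γ > 1`.  There is a constant `C > 0`, depending
only on `β`, `γ` and `T`, such that for every `β`-Hölder path `y` (with Hölder constant
`Cy` and `‖y‖_∞ ≤ My`) and any two fields `Y, Ỹ`, differentiable in space and satisfying
`|Y_{s,t}(x)| + |∇Y_{s,t}(x)| ≤ F(x)|t−s|^γ` resp. `≤ F̃(x)|t−s|^γ` with `F, F̃` locally
bounded, the corresponding nonlinear Young integrals `I = ∫ Y_{dr}(y_r)`,
`Ĩ = ∫ Ỹ_{dr}(y_r)` satisfy
`|I_{s,t} − Ĩ_{s,t}| ≤ C (1 + ‖y‖_{C^β}) ‖Y − Ỹ‖_{γ,1,B_K}` with `K = ‖y‖_∞`, where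
`D` below is any bound for the norm `‖Y − Ỹ‖_{γ,1,B_K}`. -/
theorem stmt_17 (T β γ : ℝ) (hT : 0 < T) (hβ : β ∈ Set.Ioo (0:ℝ) 1)
    (hγ : γ ∈ Set.Ioo (0:ℝ) 1) (hβγ : 1 < β + γ) :
    ∃ C : ℝ, 0 < C ∧
    ∀ (d : ℕ) (y : ℝ → Euc d) (Y Yt : ℝ → Euc d → Euc d) (F Ft : Euc d → ℝ),
    (∀ t, Differentiable ℝ (Y t)) →
    (∀ t, Differentiable ℝ (Yt t)) →
    (∀ x : Euc d, ∃ r : ℝ, 0 < r ∧ ∃ M : ℝ, ∀ x', ‖x' - x‖ ≤ r → F x' ≤ M) →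
    (∀ x : Euc d, ∃ r : ℝ, 0 < r ∧ ∃ M : ℝ, ∀ x', ‖x' - x‖ ≤ r → Ft x' ≤ M) →
    (∀ s t : ℝ, 0 ≤ s → s ≤ t → t ≤ T → ∀ x : Euc d,
      ‖Y t x - Y s x‖ + ‖fderiv ℝ (fun x' => Y t x' - Y s x') x‖ ≤ F x * (t - s) ^ γ) →
    (∀ s t : ℝ, 0 ≤ s → s ≤ t → t ≤ T → ∀ x : Euc d,
      ‖Yt t x - Yt s x‖ + ‖fderiv ℝ (fun x' => Yt t x' - Yt s x') x‖ ≤ Ft x * (t - s) ^ γ) →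
    ∀ I It : ℝ → ℝ → Euc d,
    (∀ s t : ℝ, 0 ≤ s → s ≤ t → t ≤ T →
      RiemannConv (fun u v => Y v (y u) - Y u (y u)) s t (I s t)) →
    (∀ s t : ℝ, 0 ≤ s → s ≤ t → t ≤ T →
      RiemannConv (fun u v => Yt v (y u) - Yt u (y u)) s t (It s t)) →
    ∀ My Cy D : ℝ,
    (∀ t ∈ Set.Icc (0:ℝ) T, ‖y t‖ ≤ My) →
    (∀ s ∈ Set.Icc (0:ℝ) T, ∀ t ∈ Set.Icc (0:ℝ) T, ‖y t - y s‖ ≤ Cy * |t - s| ^ β) →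
    (∀ s t : ℝ, 0 ≤ s → s ≤ t → t ≤ T → ∀ x : Euc d, ‖x‖ ≤ My →
      ‖(Y t x - Y s x) - (Yt t x - Yt s x)‖
        + ‖fderiv ℝ (fun x' => (Y t x' - Y s x') - (Yt t x' - Yt s x')) x‖ ≤ D * (t - s) ^ γ) →
    ∀ s t : ℝ, 0 ≤ s → s ≤ t → t ≤ T →
      ‖I s t - It s t‖ ≤ C * (1 + Cy) * D := by
  have hθ : 0 < β + γ := by linarith
  have hr1 : (2 : ℝ) ^ (1 - (β + γ)) < 1 :=
    Real.rpow_lt_one_of_one_lt_of_neg one_lt_two (by linarith)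
  have hq : 0 < (1 - (2 : ℝ) ^ (1 - (β + γ)))⁻¹ := inv_pos.2 (sub_pos.2 hr1)
  have hTγ : 0 < T ^ γ := Real.rpow_pos_of_pos hT _
  have hTθ : 0 < T ^ (β + γ) := Real.rpow_pos_of_pos hT _
  refine ⟨T ^ γ + T ^ (β + γ) * (1 - (2 : ℝ) ^ (1 - (β + γ)))⁻¹, by positivity, ?_⟩
  intro d y Y Yt F Ft hY hYt _ _ _ _ I It hI hIt My Cy D hMy hCy hD s t hs hst htT
  have h0T : (0 : ℝ) ∈ Set.Icc 0 T := ⟨le_rfl, hT.le⟩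
  have hCy0 : 0 ≤ Cy := by
    have h := (norm_nonneg _).trans (hCy 0 h0T T ⟨hT.le, le_rfl⟩)
    exact nonneg_of_mul_nonneg_left h (Real.rpow_pos_of_pos (by simpa using hT.ne') _)
  have hD0 : 0 ≤ D := by
    have h := (add_nonneg (norm_nonneg _) (norm_nonneg _)).trans
      (hD 0 T le_rfl hT.le le_rfl (y 0) (hMy 0 h0T))
    exact nonneg_of_mul_nonneg_left h (by simpa using hTγ)
  set Z : ℝ → ℝ → Euc d → Euc d := fun u v x => (Y v x - Y u x) - (Yt v x - Yt u x) with hZ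
  have hZdiff : ∀ u v, Differentiable ℝ (Z u v) := fun u v =>
    ((hY v).sub (hY u)).sub ((hYt v).sub (hYt u))
  have hgerm : ∀ u m v : ℝ, s ≤ u → u ≤ m → m ≤ v → v ≤ t →
      ‖Z u m (y u) + Z m v (y m) - Z u v (y u)‖ ≤ D * Cy * (v - u) ^ (β + γ) := by
    intro u m v hu hum hmv hv
    have hadd : Z u m (y u) + Z m v (y m) - Z u v (y u) = Z m v (y m) - Z m v (y u) := by
      simp only [hZ]; abel
    have humem : u ∈ Set.Icc (0 : ℝ) T := ⟨by linarith, by linarith⟩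
    have hmmem : m ∈ Set.Icc (0 : ℝ) T := ⟨by linarith, by linarith⟩
    have hlip : ‖Z m v (y m) - Z m v (y u)‖ ≤ D * (v - m) ^ γ * ‖y m - y u‖ := by
      refine (convex_closedBall (0 : Euc d) My).norm_image_sub_le_of_norm_fderiv_le
        (𝕜 := ℝ) (fun x _ => hZdiff m v x) (fun x hx => ?_)
        (mem_closedBall_zero_iff.2 (hMy u humem)) (mem_closedBall_zero_iff.2 (hMy m hmmem))
      exact (le_add_of_nonneg_left (norm_nonneg _)).trans
        (hD m v hmmem.1 hmv (by linarith) x (mem_closedBall_zero_iff.1 hx))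
    have hvm : (v - m) ^ γ ≤ (v - u) ^ γ :=
      Real.rpow_le_rpow (by linarith) (by linarith) hγ.1.le
    have hmu : (m - u) ^ β ≤ (v - u) ^ β :=
      Real.rpow_le_rpow (by linarith) (by linarith) hβ.1.le
    have hy : ‖y m - y u‖ ≤ Cy * (v - u) ^ β := by
      have h := hCy u humem m hmmem
      rw [abs_of_nonneg (sub_nonneg.2 hum)] at h
      exact h.trans (by gcongr)
    have hvu : 0 ≤ v - u := by linarith
    rw [hadd]
    calc _ ≤ D * (v - m) ^ γ * ‖y m - y u‖ := hlip
      _ ≤ D * (v - u) ^ γ * (Cy * (v - u) ^ β) := by gcongr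
      _ = D * Cy * (v - u) ^ (β + γ) := by
        rw [Real.rpow_add_of_nonneg hvu hβ.1.le hγ.1.le]; ring
  have hsew := ((hI s t hs hst htT).sub (hIt s t hs hst htT)).norm_sub_le hst hβγ
    (mul_nonneg hD0 hCy0) hgerm
  have hstart : ‖Z s t (y s)‖ ≤ D * (t - s) ^ γ :=
    (le_add_of_nonneg_right (norm_nonneg _)).trans
      (hD s t hs hst htT (y s) (hMy s ⟨hs, hst.trans htT⟩))
  have hst0 : 0 ≤ t - s := sub_nonneg.2 hst
  have hγT : (t - s) ^ γ ≤ T ^ γ := Real.rpow_le_rpow hst0 (by linarith) hγ.1.le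
  have hθT : (t - s) ^ (β + γ) ≤ T ^ (β + γ) := Real.rpow_le_rpow hst0 (by linarith) hθ.le
  set q := (1 - (2 : ℝ) ^ (1 - (β + γ)))⁻¹
  calc ‖I s t - It s t‖ ≤ ‖I s t - It s t - Z s t (y s)‖ + ‖Z s t (y s)‖ :=
        norm_le_norm_sub_add _ _
    _ ≤ D * Cy * (t - s) ^ (β + γ) * q + D * (t - s) ^ γ := add_le_add hsew hstart
    _ ≤ D * Cy * T ^ (β + γ) * q + D * T ^ γ := by gcongr
    _ ≤ D * Cy * T ^ (β + γ) * q + D * T ^ γ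
          + (D * Cy * T ^ γ + D * T ^ (β + γ) * q) := le_add_of_nonneg_right (by positivity)
    _ = (T ^ γ + T ^ (β + γ) * q) * (1 + Cy) * D := by ring
end
end
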